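/- arXiv:math/0209136 — 3 statements merged into one kernel-verified Lean document; each statement's English description precedes it below -/
import Mathlib

section
/- Fix positive integers a, b and let R = (b^a). Suppose a rational linear combination Σ_{λ self-complementary} a_λ · s_λ² + Σ b_{\{μ,μ^c\}} · s_μ s_{μ^c} = 0 in Λ, where the second sum runs over unordered pairs {μ, μ^c} of partitions contained in R that are complementary in R with μ ≠ μ^c. Then a_λ = 0 for every self-complementary λ ⊆ R; that is, the squares s_λ² of the self-complementary Schur functions are linearly independent of all the other products s_μ s_{μ^c}. -/
open scoped Classical

/-!  Common definitions: the ring `Λ` of symmetric functions is realized inside the ring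
`MvPowerSeries ℕ ℚ` of formal power series in countably many variables `x₀, x₁, x₂, …`
with rational coefficients; Schur functions are defined by their monomial expansion over
semistandard Young tableaux, and Littlewood–Richardson coefficients are defined as the
number of Littlewood–Richardson fillings (semistandard skew fillings whose reverse reading
word is a lattice word), which is the coefficient of `s_ν` in `s_lam ⬝ s_μ`. -/

/-- The Schur function `s_μ` of a Young diagram `μ`: the coefficient of the monomial `x^m`
is the number of semistandard Young tableaux of shape `μ` with weight `m`. -/
noncomputable def schur (μ : YoungDiagram) : MvPowerSeries ℕ ℚ :=
  fun m : ℕ →₀ ℕ =>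
    (Set.ncard {T : SemistandardYoungTableau μ |
        ∀ k : ℕ, (μ.cells.filter fun c => T c.1 c.2 = k).card = m k} : ℚ)

/-- A Littlewood–Richardson filling of the skew shape `ν/lam` with content `μ`:
a filling of the cells of `ν` not in `lam` with entries `0, 1, 2, …` that is weakly
increasing along rows, strictly increasing down columns, in which the entry `k` occurs
`μ.rowLen k` times, and such that reading right-to-left along rows, top to bottom, every
initial segment contains at least as many `k`'s as `(k+1)`'s (the lattice word condition). -/
structure LRFilling (ν lam μ : YoungDiagram) : Type where
  le : lam ≤ ν
  entry : ℕ → ℕ → ℕ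
  zeros : ∀ i j, (i, j) ∉ ν.cells \ lam.cells → entry i j = 0
  row_weak : ∀ i j, (i, j) ∈ ν.cells \ lam.cells → (i, j + 1) ∈ ν.cells \ lam.cells →
    entry i j ≤ entry i (j + 1)
  col_strict : ∀ i j, (i, j) ∈ ν.cells \ lam.cells → (i + 1, j) ∈ ν.cells \ lam.cells →
    entry i j < entry (i + 1) j
  content : ∀ k, ((ν.cells \ lam.cells).filter fun c => entry c.1 c.2 = k).card = μ.rowLen k
  lattice : ∀ i j k,
    ((ν.cells \ lam.cells).filter fun c =>
        (c.1 < i ∨ (c.1 = i ∧ j ≤ c.2)) ∧ entry c.1 c.2 = k + 1).card ≤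
    ((ν.cells \ lam.cells).filter fun c =>
        (c.1 < i ∨ (c.1 = i ∧ j ≤ c.2)) ∧ entry c.1 c.2 = k).card

/-- The Littlewood–Richardson coefficient `c^ν_{lam,μ}`, i.e. the coefficient of the
Schur function `s_ν` in the product `s_lam ⬝ s_μ`. -/
noncomputable def lrCoeff (ν lam μ : YoungDiagram) : ℕ :=
  Nat.card (LRFilling ν lam μ)

/-- The `a × b` rectangular Young diagram `R = (b^a)`. -/
def rect (a b : ℕ) : YoungDiagram :=
  ⟨Finset.range a ×ˢ Finset.range b, by
    rintro ⟨i, j⟩ ⟨i', j'⟩ ⟨hi, hj⟩ h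
    simp only [Finset.coe_product, Finset.coe_range, Set.mem_prod, Set.mem_Iio] at h ⊢
    exact ⟨lt_of_le_of_lt hi h.1, lt_of_le_of_lt hj h.2⟩⟩

/-- The complement `μᶜ` of `μ` in the `a × b` rectangle: the boxes of the rectangle
not in `μ`, rotated by 180°; its parts are `(μᶜ)ᵢ = b - μ_{a+1-i}` for `1 ≤ i ≤ a`. -/
def rectCompl (a b : ℕ) (μ : YoungDiagram) : YoungDiagram :=
  ⟨(rect a b).cells.filter fun c => (a - 1 - c.1, b - 1 - c.2) ∉ μ, by
    rintro ⟨i, j⟩ ⟨i', j'⟩ ⟨hi, hj⟩ h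
    simp only [Finset.coe_filter, Set.mem_setOf_eq] at h ⊢
    refine ⟨(rect a b).isLowerSet ⟨hi, hj⟩ h.1, fun hmem => h.2 ?_⟩
    exact μ.isLowerSet ⟨Nat.sub_le_sub_left hi _, Nat.sub_le_sub_left hj _⟩ hmem⟩

/-- Greedy `w`-decomposition piece sizes, starting from the state where `r` horizontal and
`c` vertical pieces have already been taken.  The letter `true` stands for `h` (a horizontal
piece: the rest of row `r`), `false` for `v` (a vertical piece: the rest of column `c`). -/
def wPieces : List Bool → ℕ → ℕ → YoungDiagram → List ℕ
  | [], _, _, _ => []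
  | true :: w, r, c, lam => (lam.rowLen r - c) :: wPieces w (r + 1) c lam
  | false :: w, r, c, lam => (lam.colLen c - r) :: wPieces w r (c + 1) lam

/-- The `w`-notation `lam^w` of a partition `lam`: the list of piece sizes of its greedy
`w`-decomposition. -/
def wNotation (w : List Bool) (lam : YoungDiagram) : List ℕ :=
  wPieces w 0 0 lam

/-- `lexLE l₁ l₂` : `l₁ ≤ l₂` in lexicographic order. -/
def lexLE (l₁ l₂ : List ℕ) : Prop :=
  l₁ = l₂ ∨ List.Lex (· < ·) l₁ l₂

/-- Remove the first row of a Young diagram. -/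
def stripRow (lam : YoungDiagram) : YoungDiagram :=
  ⟨(lam.cells.filter fun c => 0 < c.1).image fun c => (c.1 - 1, c.2), by
    rintro ⟨i', j'⟩ ⟨i, j⟩ ⟨hi, hj⟩ h
    simp only [Finset.coe_image, Finset.coe_filter, Set.mem_image, Set.mem_setOf_eq,
      Prod.exists] at h ⊢
    obtain ⟨x, y, ⟨hxy, hx⟩, heq⟩ := h
    obtain ⟨hx1, rfl⟩ : x - 1 = i' ∧ y = j' := by simpa [Prod.ext_iff] using heq
    exact ⟨i + 1, j, ⟨lam.isLowerSet (b := (i + 1, j)) ⟨by omega, by simpa using hj⟩ hxy,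
      by omega⟩, by simp⟩⟩

/-- Remove the first column of a Young diagram. -/
def stripCol (lam : YoungDiagram) : YoungDiagram :=
  (stripRow lam.transpose).transpose

/-- For `a`, `b` both odd, `lam` is almost self-complementary in the `a × b` rectangle if
`lam` is contained in the rectangle and the diagrams of `lam` and of its complement differ
only in which one contains the central box (row `(a+1)/2`, column `(b+1)/2`, 1-indexed). -/
def AlmostSelfCompl (a b : ℕ) (lam : YoungDiagram) : Prop :=
  lam ≤ rect a b ∧
    lam.cells \ (rectCompl a b lam).cells ∪ (rectCompl a b lam).cells \ lam.cells =
      {((a - 1) / 2, (b - 1) / 2)}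



/-! ## Part 1: partitions as finitely supported functions, and Schur polynomials by branching -/

namespace SqInd

/-- inner shapes `ν` such that `μ/ν` is a horizontal strip -/
noncomputable def hs (μ : ℕ →₀ ℕ) : Finset (ℕ →₀ ℕ) :=
  (Finset.Icc 0 μ).filter fun ν => ∀ i, μ (i + 1) ≤ ν i

/-- inner shapes `κ` such that `μ/κ` is a vertical strip -/
noncomputable def vs (μ : ℕ →₀ ℕ) : Finset (ℕ →₀ ℕ) :=
  (Finset.Icc 0 μ).filter fun κ => Antitone κ ∧ ∀ i, μ i ≤ κ i + 1

lemma mem_hs {μ ν : ℕ →₀ ℕ} : ν ∈ hs μ ↔ ν ≤ μ ∧ ∀ i, μ (i + 1) ≤ ν i := by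
  simp [hs]

lemma mem_vs {μ κ : ℕ →₀ ℕ} : κ ∈ vs μ ↔ κ ≤ μ ∧ Antitone κ ∧ ∀ i, μ i ≤ κ i + 1 := by
  simp [vs]

lemma hs_antitone {μ ν : ℕ →₀ ℕ} (h : ν ∈ hs μ) : Antitone ν := by
  rw [mem_hs] at h
  exact antitone_nat_of_succ_le fun i => le_trans (h.1 (i + 1)) (h.2 i)

lemma self_mem_hs {μ : ℕ →₀ ℕ} (h : Antitone μ) : μ ∈ hs μ :=
  mem_hs.2 ⟨le_rfl, fun i => h (Nat.le_succ i)⟩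

lemma self_mem_vs {μ : ℕ →₀ ℕ} (h : Antitone μ) : μ ∈ vs μ :=
  mem_vs.2 ⟨le_rfl, h, fun i => Nat.le_succ _⟩

/-- the Schur polynomial in the variables `x 0, ..., x (n-1)` -/
noncomputable def K {R : Type} [CommRing R] (x : ℕ → R) : ℕ → (ℕ →₀ ℕ) → R
  | 0, μ => if μ = 0 then 1 else 0
  | n + 1, μ => ∑ ν ∈ hs μ, x n ^ (Finsupp.degree (μ - ν)) * K x n ν

lemma K_map {R S : Type} [CommRing R] [CommRing S] (f : R →+* S) (x : ℕ → R) (n : ℕ)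
    (μ : ℕ →₀ ℕ) : f (K x n μ) = K (fun i => f (x i)) n μ := by
  induction n generalizing μ with
  | zero => simp only [K]; split_ifs <;> simp
  | succ n ih => simp [K, ih]

lemma K_congr {R : Type} [CommRing R] (x y : ℕ → R) (n : ℕ) (h : ∀ i < n, x i = y i)
    (μ : ℕ →₀ ℕ) : K x n μ = K y n μ := by
  induction n generalizing μ with
  | zero => rfl
  | succ n ih =>
    simp only [K]
    rw [h n (by omega)]
    refine Finset.sum_congr rfl fun ν _ => ?_
    rw [ih (fun i hi => h i (by omega))]

lemma deg_sub {μ ν : ℕ →₀ ℕ} (h : ν ≤ μ) :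
    Finsupp.degree (μ - ν) + Finsupp.degree ν = Finsupp.degree μ := by
  rw [← map_add, tsub_add_cancel_of_le h]

lemma deg_zero {μ : ℕ →₀ ℕ} (h : Finsupp.degree μ = 0) : μ = 0 :=
  (Finsupp.degree_eq_zero_iff μ).1 h

lemma eq_of_deg {μ ν : ℕ →₀ ℕ} (h : ν ≤ μ) (h2 : Finsupp.degree ν = Finsupp.degree μ) : ν = μ := by
  have := deg_sub h
  have h3 : Finsupp.degree (μ - ν) = 0 := by omega
  have := deg_zero h3
  exact le_antisymm h (tsub_eq_zero_iff_le.1 this)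

lemma deg_range {μ : ℕ →₀ ℕ} {N : ℕ} (h : ∀ i, N ≤ i → μ i = 0) :
    Finsupp.degree μ = ∑ i ∈ Finset.range N, μ i := by
  rw [Finsupp.degree_apply]
  refine Finset.sum_subset (fun i hi => ?_) (fun i _ hi => by simpa using hi)
  rw [Finset.mem_range]
  by_contra hc
  exact (Finsupp.mem_support_iff.1 hi) (h i (by omega))

lemma exists_bound (μ : ℕ →₀ ℕ) : ∃ N, ∀ i, N ≤ i → μ i = 0 := by
  refine ⟨μ.support.sup id + 1, fun i hi => ?_⟩
  by_contra hc
  have : i ≤ μ.support.sup id := Finset.le_sup (f := id) (Finsupp.mem_support_iff.2 hc)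
  omega

/-- remove the first row -/
noncomputable def sh (μ : ℕ →₀ ℕ) : ℕ →₀ ℕ :=
  Finsupp.comapDomain Nat.succ μ (Nat.succ_injective.injOn)

lemma sh_apply (μ : ℕ →₀ ℕ) (i : ℕ) : sh μ i = μ (i + 1) := rfl

lemma deg_sh (μ : ℕ →₀ ℕ) : Finsupp.degree μ = μ 0 + Finsupp.degree (sh μ) := by
  obtain ⟨N, hN⟩ := exists_bound μ
  rw [deg_range (N := N + 1) (fun i hi => hN i (by omega)),
    deg_range (N := N) (μ := sh μ) (fun i hi => hN (i + 1) (by omega)),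
    Finset.sum_range_succ', add_comm]
  rfl

/-- remove the first column -/
noncomputable def co (μ : ℕ →₀ ℕ) : ℕ →₀ ℕ := μ.mapRange (fun k => k - 1) rfl

lemma co_apply (μ : ℕ →₀ ℕ) (i : ℕ) : co μ i = μ i - 1 := by simp [co]

section poly

open Polynomial

/-- `K (n+1)` as polynomial in the last variable -/
noncomputable def Q (x : ℕ → ℚ) (n : ℕ) (μ : ℕ →₀ ℕ) : ℚ[X] :=
  ∑ ν ∈ hs μ, C (K x n ν) * X ^ (Finsupp.degree (μ - ν))

lemma Q_eval (x : ℕ → ℚ) (n : ℕ) (μ : ℕ →₀ ℕ) (t : ℚ) :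
    (Q x n μ).eval t = K (Function.update x n t) (n + 1) μ := by
  simp only [Q, eval_finsetSum, K, eval_mul, eval_C, eval_pow, eval_X, Function.update_self]
  refine Finset.sum_congr rfl fun ν _ => ?_
  rw [mul_comm, K_congr x (Function.update x n t)]
  intro i hi
  rw [Function.update_of_ne (by omega)]

lemma hs_deg {μ ν : ℕ →₀ ℕ} (h : ν ∈ hs μ) : Finsupp.degree (μ - ν) ≤ μ 0 := by
  rw [mem_hs] at h
  have h1 := deg_sub h.1
  have h2 := deg_sh μ
  have h3 : Finsupp.degree (sh μ) ≤ Finsupp.degree ν := Finsupp.degree_mono fun i => h.2 i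
  omega

lemma hs_deg_eq {μ ν : ℕ →₀ ℕ} (h : ν ∈ hs μ) (e : Finsupp.degree (μ - ν) = μ 0) : ν = sh μ := by
  rw [mem_hs] at h
  have h1 := deg_sub h.1
  have h2 := deg_sh μ
  exact (eq_of_deg (fun i => h.2 i) (by omega)).symm

lemma sh_mem {μ : ℕ →₀ ℕ} (h : Antitone μ) : sh μ ∈ hs μ :=
  mem_hs.2 ⟨fun i => h (Nat.le_succ i), fun i => le_rfl⟩

lemma deg_sub_sh {μ : ℕ →₀ ℕ} (h : Antitone μ) : Finsupp.degree (μ - sh μ) = μ 0 := by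
  have h1 := deg_sub (mem_hs.1 (sh_mem h)).1
  have h2 := deg_sh μ
  omega

lemma Q_natDegree (x : ℕ → ℚ) (n : ℕ) (μ : ℕ →₀ ℕ) : (Q x n μ).natDegree ≤ μ 0 := by
  refine natDegree_sum_le_of_forall_le _ _ fun ν hν => ?_
  exact (natDegree_C_mul_X_pow_le _ _).trans (hs_deg hν)

lemma Q_coeff (x : ℕ → ℚ) (n : ℕ) (μ : ℕ →₀ ℕ) (h : Antitone μ) :
    (Q x n μ).coeff (μ 0) = K x n (sh μ) := by
  simp only [Q, finsetSum_coeff, coeff_C_mul_X_pow]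
  rw [Finset.sum_eq_single_of_mem (sh μ) (sh_mem h)]
  · rw [if_pos (deg_sub_sh h).symm]
  · intro ν hν hne
    rw [if_neg fun e => hne (hs_deg_eq hν e.symm)]

lemma Q_coeff_zero (x : ℕ → ℚ) (n : ℕ) (μ : ℕ →₀ ℕ) (h : Antitone μ) :
    (Q x n μ).coeff 0 = K x n μ := by
  simp only [Q, finsetSum_coeff, coeff_C_mul_X_pow]
  rw [Finset.sum_eq_single_of_mem μ (self_mem_hs h)]
  · simp
  · intro ν hν hne
    rw [if_neg]
    intro e
    refine hne (eq_of_deg (mem_hs.1 hν).1 ?_)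
    have := deg_sub (mem_hs.1 hν).1
    omega

/-- A linear relation among products of pairs of Schur functions. -/
def Rel {ι : Type} (s : Finset ι) (g : ι → ℚ) (α β : ι → (ℕ →₀ ℕ)) : Prop :=
  ∀ (n : ℕ) (x : ℕ → ℚ), ∑ i ∈ s, g i * (K x n (α i) * K x n (β i)) = 0

lemma Rel.Q_zero {ι : Type} {s : Finset ι} {g : ι → ℚ} {α β : ι → (ℕ →₀ ℕ)} (h : Rel s g α β)
    (n : ℕ) (x : ℕ → ℚ) : ∑ i ∈ s, C (g i) * (Q x n (α i) * Q x n (β i)) = 0 := by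
  refine Polynomial.funext fun t => ?_
  simp only [eval_finsetSum, eval_mul, eval_C, Q_eval, eval_zero]
  exact h (n + 1) _

lemma Rel.row {ι : Type} {s : Finset ι} {g : ι → ℚ} {α β : ι → (ℕ →₀ ℕ)} (h : Rel s g α β)
    (hα : ∀ i ∈ s, Antitone (α i)) (hβ : ∀ i ∈ s, Antitone (β i)) (A B : ℕ)
    (hA : ∀ i ∈ s, α i 0 ≤ A) (hB : ∀ i ∈ s, β i 0 ≤ B) :
    Rel (s.filter fun i => α i 0 = A ∧ β i 0 = B) g (fun i => sh (α i)) (fun i => sh (β i)) := by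
  intro n x
  have h1 := congrArg (fun p => p.coeff (A + B)) (h.Q_zero n x)
  simp only [finsetSum_coeff, coeff_C_mul, coeff_zero] at h1
  rw [Finset.sum_filter]
  refine Eq.trans ?_ h1
  refine Finset.sum_congr rfl fun i hi => ?_
  rw [coeff_mul_add_eq_of_natDegree_le ((Q_natDegree _ _ _).trans (hA i hi))
    ((Q_natDegree _ _ _).trans (hB i hi))]
  split_ifs with hc
  · rw [← hc.1, ← hc.2, Q_coeff _ _ _ (hα i hi), Q_coeff _ _ _ (hβ i hi)]
  · rcases lt_or_eq_of_le (hA i hi) with hlt | heq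
    · rw [coeff_eq_zero_of_natDegree_lt ((Q_natDegree _ _ _).trans_lt hlt)]; simp
    · rcases lt_or_eq_of_le (hB i hi) with hlt | heq2
      · rw [coeff_eq_zero_of_natDegree_lt (p := Q x n (β i)) ((Q_natDegree _ _ _).trans_lt hlt)]
        simp
      · exact absurd ⟨heq, heq2⟩ hc

/-- the vertical-strip analogue of `Q` -/
noncomputable def E {R : Type} [CommRing R] (φ : (ℕ →₀ ℕ) → R) (μ : ℕ →₀ ℕ) : R[X] :=
  ∑ κ ∈ vs μ, C (φ κ) * ((-1) ^ (Finsupp.degree (μ - κ)) * X ^ (Finsupp.degree (μ - κ)))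

lemma E_map {R S : Type} [CommRing R] [CommRing S] (f : R →+* S) (φ : (ℕ →₀ ℕ) → R)
    (μ : ℕ →₀ ℕ) : (E φ μ).map f = E (fun κ => f (φ κ)) μ := by
  simp [E, Polynomial.map_sum]

/-- sign cancellation -/
lemma strip_sum {μ ν : ℕ →₀ ℕ} (hμ : Antitone μ) (hne : ν ≠ μ) :
    ∑ κ ∈ (vs μ).filter (fun κ => ν ∈ hs κ), (-1 : ℚ) ^ (Finsupp.degree (μ - κ)) = 0 := by
  by_cases hle : ν ≤ μ
  swap
  · rw [Finset.sum_eq_zero]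
    intro κ hκ
    rw [Finset.mem_filter, mem_vs, mem_hs] at hκ
    exact absurd (hκ.2.1.trans hκ.1.1) hle
  have hex : ∃ i, ν i < μ i := by
    by_contra hc
    push Not at hc
    exact hne (le_antisymm hle fun i => hc i)
  classical
  obtain ⟨i, hi, hmin⟩ : ∃ i, ν i < μ i ∧ ∀ j < i, ν j = μ j :=
    ⟨Nat.find hex, Nat.find_spec hex, fun j hj =>
      le_antisymm (hle j) (not_lt.1 (Nat.find_min hex hj))⟩
  have key : ∀ κ ∈ (vs μ).filter (fun κ => ν ∈ hs κ),
      ∀ c, (c = μ i ∨ c + 1 = μ i) → κ.update i c ∈ (vs μ).filter (fun κ => ν ∈ hs κ) := by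
    intro κ hκ c hc
    rw [Finset.mem_filter, mem_vs, mem_hs] at hκ
    obtain ⟨⟨h1, h2, h3⟩, h4, h5⟩ := hκ
    have hup : ∀ j, (κ.update i c) j = if j = i then c else κ j := by
      intro j; simp [Finsupp.update_apply]
    have a4 : ν ≤ κ.update i c := by
      intro j
      rw [hup]
      split_ifs with hj
      · subst hj; omega
      · exact h4 j
    have a5 : ∀ j, (κ.update i c) (j + 1) ≤ ν j := by
      intro j
      rw [hup]
      split_ifs with hj
      · rw [hmin j (by omega)]
        have : μ i ≤ μ j := hμ (by omega)
        omega
      · exact h5 j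
    rw [Finset.mem_filter, mem_vs, mem_hs]
    refine ⟨⟨?_, ?_, ?_⟩, a4, a5⟩
    · intro j
      rw [hup]
      split_ifs with hj
      · subst hj; omega
      · exact h1 j
    · exact antitone_nat_of_succ_le fun j => (a5 j).trans (a4 j)
    · intro j
      rw [hup]
      split_ifs with hj
      · subst hj; omega
      · exact h3 j
  have hval : ∀ κ ∈ (vs μ).filter (fun κ => ν ∈ hs κ), κ i = μ i ∨ κ i + 1 = μ i := by
    intro κ hκ
    rw [Finset.mem_filter, mem_vs] at hκ
    have := hκ.1.1 i
    have := hκ.1.2.2 i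
    omega
  let tog : ∀ κ : ℕ →₀ ℕ, ℕ →₀ ℕ := fun κ =>
    κ.update i (if κ i = μ i then μ i - 1 else μ i)
  have htm : ∀ κ ∈ (vs μ).filter (fun κ => ν ∈ hs κ),
      tog κ ∈ (vs μ).filter (fun κ => ν ∈ hs κ) := by
    intro κ hκ
    apply key κ hκ
    split_ifs <;> omega
  have hdeg : ∀ (κ : ℕ →₀ ℕ) (c : ℕ), Finsupp.degree (κ.update i c) + κ i = Finsupp.degree κ + c := by
    intro κ c
    have h1 : κ.update i c + Finsupp.single i (κ i) = κ + Finsupp.single i c := by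
      ext j
      by_cases hj : j = i
      · subst hj; simp [add_comm]
      · simp [Finsupp.update_apply, hj, Finsupp.single_apply, Ne.symm hj]
    simpa using congrArg Finsupp.degree h1
  refine Finset.sum_involution (fun κ _ => tog κ) ?_ ?_ (fun κ hκ => htm κ hκ) ?_
  · intro κ hκ
    have hm := htm κ hκ
    have e1 := deg_sub (mem_vs.1 (Finset.mem_filter.1 hκ).1).1
    have e2 := deg_sub (mem_vs.1 (Finset.mem_filter.1 hm).1).1
    have e3 := hdeg κ (if κ i = μ i then μ i - 1 else μ i)
    have e4 := hval κ hκ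
    change Finsupp.degree (tog κ) + κ i = _ at e3
    have : Finsupp.degree (μ - κ) = Finsupp.degree (μ - tog κ) + 1 ∨
        Finsupp.degree (μ - tog κ) = Finsupp.degree (μ - κ) + 1 := by
      split_ifs at e3 <;> omega
    rcases this with e | e <;> rw [e, pow_succ] <;> ring
  · intro κ hκ _ heq
    have e4 := hval κ hκ
    have := DFunLike.congr_fun heq i
    simp only [tog, Finsupp.update_apply, if_true] at this
    split_ifs at this <;> omega
  · intro κ hκ
    have e4 := hval κ hκ
    ext j
    by_cases hj : j = i
    · subst hj
      simp only [tog, Finsupp.update_apply, if_true]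
      split_ifs <;> omega
    · simp [tog, Finsupp.update_apply, hj]

lemma EQ (x : ℕ → ℚ) (n : ℕ) {μ : ℕ →₀ ℕ} (hμ : Antitone μ) :
    (E (Q x n) μ).eval X = C (K x n μ) := by
  simp only [E, eval_finsetSum, eval_mul, eval_C, eval_pow, eval_X, Q, eval_neg, eval_one,
    Finset.sum_mul]
  rw [Finset.sum_comm' (t' := Finset.Icc 0 μ)
    (s' := fun ν => (vs μ).filter (fun κ => ν ∈ hs κ))]
  · rw [Finset.sum_eq_single_of_mem μ (by simp)]
    · rw [Finset.sum_eq_single_of_mem μ]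
      · simp
      · rw [Finset.mem_filter]
        exact ⟨self_mem_vs hμ, self_mem_hs hμ⟩
      · intro κ hκ hne
        rw [Finset.mem_filter, mem_vs, mem_hs] at hκ
        exact absurd (le_antisymm hκ.1.1 hκ.2.1) hne
    · intro ν _ hne
      have := congrArg (fun q => C (K x n ν) * X ^ (Finsupp.degree (μ - ν)) * C q)
        (strip_sum hμ hne)
      simp only [map_zero, mul_zero, map_sum, Finset.mul_sum] at this
      rw [← this]
      refine Finset.sum_congr rfl fun κ hκ => ?_
      rw [Finset.mem_filter, mem_vs, mem_hs] at hκ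
      have e : Finsupp.degree (μ - ν) = Finsupp.degree (μ - κ) + Finsupp.degree (κ - ν) := by
        rw [← map_add, tsub_add_tsub_cancel hκ.1.1 hκ.2.1]
      rw [e, pow_add]
      simp
      ring
  · intro κ ν
    simp only [Finset.mem_filter, Finset.mem_Icc, zero_le, true_and]
    constructor
    · intro h
      exact ⟨h, (mem_hs.1 h.2).1.trans (mem_vs.1 h.1).1⟩
    · intro h
      exact h.1

lemma Rel.E_zero {ι : Type} {s : Finset ι} {g : ι → ℚ} {α β : ι → (ℕ →₀ ℕ)} (h : Rel s g α β)
    (hα : ∀ i ∈ s, Antitone (α i)) (hβ : ∀ i ∈ s, Antitone (β i)) (k : ℕ) :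
    ∀ (n : ℕ) (x : ℕ → ℚ),
      (∑ i ∈ s, C (g i) * (E (K x n) (α i) * E (K x n) (β i))).coeff k = 0 := by
  induction k using Nat.strong_induction_on with
  | _ k ih =>
  intro n x
  set G : ℚ[X][X] := ∑ i ∈ s, C (C (g i)) * (E (Q x n) (α i) * E (Q x n) (β i)) with hG
  have hmap : ∀ t : ℚ, G.map (evalRingHom t) = ∑ i ∈ s, C (g i) *
      (E (K (Function.update x n t) (n + 1)) (α i) * E (K (Function.update x n t) (n + 1)) (β i)) := by
    intro t
    simp only [hG, Polynomial.map_sum, Polynomial.map_mul, E_map, map_C, coe_evalRingHom, eval_C,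
      Q_eval]
  have hlow : X ^ k ∣ G := by
    rw [X_pow_dvd_iff]
    intro d hd
    refine Polynomial.funext fun t => ?_
    have := ih d hd (n + 1) (Function.update x n t)
    rw [← hmap, coeff_map, coe_evalRingHom] at this
    rw [this, eval_zero]
  have hev : G.eval X = 0 := by
    simp only [hG, eval_finsetSum, eval_mul, eval_C]
    have := congrArg (C : ℚ →+* ℚ[X]) (h n x)
    rw [map_sum, map_zero] at this
    rw [← this]
    refine Finset.sum_congr rfl fun i hi => ?_
    rw [EQ x n (hα i hi), EQ x n (hβ i hi)]
    simp
  obtain ⟨G', hG'⟩ := hlow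
  have h0 : G'.eval X = 0 := by
    rw [hG', eval_mul, eval_pow, eval_X] at hev
    exact (mul_eq_zero.1 hev).resolve_left (pow_ne_zero _ X_ne_zero)
  have h1 : (G'.coeff 0).coeff 0 = 0 := by
    have h2 := congrArg (fun p => p.coeff 0) h0
    simp only [coeff_zero] at h2
    rw [← h2, coeff_zero_eq_eval_zero (G'.eval X), ← coe_evalRingHom, ← Polynomial.eval₂_id,
      Polynomial.hom_eval₂, coe_evalRingHom, eval_X, RingHomCompTriple.comp_eq,
      Polynomial.eval₂_at_zero]
    simp [coeff_zero_eq_eval_zero]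
  have h3 : G.coeff k = G'.coeff 0 := by
    rw [hG']
    simpa using coeff_X_pow_mul G' k 0
  rw [← h3] at h1
  have h4 := congrArg (fun p => p.coeff k) (hmap 0)
  simp only [coeff_map, coe_evalRingHom] at h4
  rw [← coeff_zero_eq_eval_zero, h1] at h4
  rw [h4]
  have : ∀ μ, E (K x n) μ = E (K (Function.update x n 0) (n + 1)) μ := by
    intro μ
    refine Finset.sum_congr rfl fun κ hκ => ?_
    rw [← Q_coeff_zero x n κ (mem_vs.1 hκ).2.1, coeff_zero_eq_eval_zero, Q_eval]
  simp only [this]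

lemma vs_deg {μ κ : ℕ →₀ ℕ} {A : ℕ} (hA : ∀ j, A ≤ j → μ j = 0) (h : κ ∈ vs μ) :
    Finsupp.degree (μ - κ) ≤ A := by
  rw [mem_vs] at h
  rw [deg_range (N := A)]
  · refine (Finset.sum_le_card_nsmul _ _ 1 fun i _ => ?_).trans (by simp)
    have := h.2.2 i
    simp only [Finsupp.coe_tsub, Pi.sub_apply]
    omega
  · intro i hi
    simp [hA i hi]

lemma vs_deg_eq {μ κ : ℕ →₀ ℕ} {A : ℕ} (hA : ∀ j, A ≤ j → μ j = 0) (h : κ ∈ vs μ)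
    (e : Finsupp.degree (μ - κ) = A) : (∀ j < A, 0 < μ j) ∧ κ = co μ := by
  rw [mem_vs] at h
  have h1 : ∀ j, (μ - κ) j ≤ 1 := by
    intro i
    have := h.2.2 i
    simp only [Finsupp.coe_tsub, Pi.sub_apply]
    omega
  rw [deg_range (N := A) (fun i hi => by simp [hA i hi])] at e
  have h2 : ∀ j ∈ Finset.range A, (μ - κ) j = 1 := by
    refine (Finset.sum_eq_sum_iff_of_le (g := fun _ => 1) (fun i _ => h1 i)).1 ?_
    simpa using e
  constructor
  · intro j hj
    have := h2 j (Finset.mem_range.2 hj)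
    simp only [Finsupp.coe_tsub, Pi.sub_apply] at this
    omega
  · ext j
    rw [co_apply]
    by_cases hj : j < A
    · have := h2 j (Finset.mem_range.2 hj)
      simp only [Finsupp.coe_tsub, Pi.sub_apply] at this
      omega
    · have := hA j (by omega)
      have := h.1 j
      omega

lemma co_antitone {μ : ℕ →₀ ℕ} (h : Antitone μ) : Antitone (co μ) := by
  intro i j hij
  rw [co_apply, co_apply]
  have := h hij
  omega

lemma co_mem {μ : ℕ →₀ ℕ} (h : Antitone μ) : co μ ∈ vs μ := by
  refine mem_vs.2 ⟨fun i => ?_, co_antitone h, fun i => ?_⟩ <;> rw [co_apply] <;> omega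

lemma co_deg {μ : ℕ →₀ ℕ} {A : ℕ} (hA : ∀ j, A ≤ j → μ j = 0) (hp : ∀ j < A, 0 < μ j) :
    Finsupp.degree (μ - co μ) = A := by
  rw [deg_range (N := A) (fun i hi => by simp [hA i hi])]
  have : ∀ j ∈ Finset.range A, (μ - co μ) j = 1 := by
    intro j hj
    have := hp j (Finset.mem_range.1 hj)
    simp only [Finsupp.coe_tsub, Pi.sub_apply, co_apply]
    omega
  rw [Finset.sum_congr rfl this]
  simp

lemma E_natDegree (φ : (ℕ →₀ ℕ) → ℚ) {μ : ℕ →₀ ℕ} {A : ℕ} (hA : ∀ j, A ≤ j → μ j = 0) :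
    (E φ μ).natDegree ≤ A := by
  refine natDegree_sum_le_of_forall_le _ _ fun κ hκ => ?_
  have : C (φ κ) * ((-1) ^ (Finsupp.degree (μ - κ)) * X ^ (Finsupp.degree (μ - κ))) =
      C (φ κ * (-1) ^ (Finsupp.degree (μ - κ))) * X ^ (Finsupp.degree (μ - κ)) := by
    simp [mul_assoc]
  rw [this]
  exact (natDegree_C_mul_X_pow_le _ _).trans (vs_deg hA hκ)

lemma E_coeff (φ : (ℕ →₀ ℕ) → ℚ) {μ : ℕ →₀ ℕ} (h : Antitone μ) {A : ℕ}
    (hA : ∀ j, A ≤ j → μ j = 0) :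
    (E φ μ).coeff A = if ∀ j < A, 0 < μ j then (-1) ^ A * φ (co μ) else 0 := by
  have this : ∀ κ, C (φ κ) * ((-1) ^ (Finsupp.degree (μ - κ)) * X ^ (Finsupp.degree (μ - κ))) =
      C (φ κ * (-1) ^ (Finsupp.degree (μ - κ))) * X ^ (Finsupp.degree (μ - κ)) := by
    intro κ
    simp [mul_assoc]
  simp only [E, this, finsetSum_coeff, coeff_C_mul_X_pow]
  split_ifs with hp
  · rw [Finset.sum_eq_single_of_mem (co μ) (co_mem h)]
    · rw [co_deg hA hp, if_pos rfl, mul_comm]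
    · intro κ hκ hne
      rw [if_neg fun e => hne (vs_deg_eq hA hκ e.symm).2]
  · refine Finset.sum_eq_zero fun κ hκ => ?_
    rw [if_neg fun e => hp (vs_deg_eq hA hκ e.symm).1]

lemma Rel.col {ι : Type} {s : Finset ι} {g : ι → ℚ} {α β : ι → (ℕ →₀ ℕ)} (h : Rel s g α β)
    (hα : ∀ i ∈ s, Antitone (α i)) (hβ : ∀ i ∈ s, Antitone (β i)) (A B : ℕ)
    (hA : ∀ i ∈ s, ∀ j, A ≤ j → α i j = 0) (hB : ∀ i ∈ s, ∀ j, B ≤ j → β i j = 0) :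
    Rel (s.filter fun i => (∀ j < A, 0 < α i j) ∧ (∀ j < B, 0 < β i j)) g
      (fun i => co (α i)) (fun i => co (β i)) := by
  intro n x
  have h1 := h.E_zero hα hβ (A + B) n x
  simp only [finsetSum_coeff, coeff_C_mul] at h1
  rw [Finset.sum_filter]
  have h2 : ((-1 : ℚ) ^ A * (-1) ^ B) * ∑ i ∈ s,
      (if (∀ j < A, 0 < α i j) ∧ (∀ j < B, 0 < β i j) then
        g i * (K x n (co (α i)) * K x n (co (β i))) else 0) = 0 := by
    rw [Finset.mul_sum]
    refine Eq.trans ?_ h1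
    refine Finset.sum_congr rfl fun i hi => ?_
    rw [coeff_mul_add_eq_of_natDegree_le (E_natDegree _ (hA i hi)) (E_natDegree _ (hB i hi)),
      E_coeff _ (hα i hi) (hA i hi), E_coeff _ (hβ i hi) (hB i hi)]
    by_cases c1 : ∀ j < A, 0 < α i j
    · by_cases c2 : ∀ j < B, 0 < β i j
      · rw [if_pos ⟨c1, c2⟩, if_pos c1, if_pos c2]; ring
      · rw [if_neg (fun c => c2 c.2), if_neg c2]; simp
    · rw [if_neg (fun c => c1 c.1), if_neg c1]; simp
  exact (mul_eq_zero.1 h2).resolve_left (by simp)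

/-- The main induction. -/
theorem main (N : ℕ) : ∀ (a b : ℕ), a + b = N → ∀ {ι : Type} (s : Finset ι) (g : ι → ℚ)
    (α β : ι → (ℕ →₀ ℕ)),
    (∀ i ∈ s, Antitone (α i)) → (∀ i ∈ s, Antitone (β i)) →
    (∀ i ∈ s, ∀ j, α i j ≤ b) → (∀ i ∈ s, ∀ j, a ≤ j → α i j = 0) →
    (∀ i ∈ s, ∀ j < a, β i j = b - α i (a - 1 - j)) → (∀ i ∈ s, ∀ j, a ≤ j → β i j = 0) →
    (∀ i ∈ s, ∀ i' ∈ s, α i = α i' → i = i') →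
    Rel s g α β → ∀ i ∈ s, α i = β i → g i = 0 := by
  induction N using Nat.strong_induction_on with
  | _ N ih =>
  intro a b hab ι s g α β hα hβ hαb hαa hβv hβa hinj hrel i hi hself
  by_cases h0 : a = 0 ∨ b = 0
  · have hz : ∀ i ∈ s, α i = 0 := by
      intro i hi
      ext j
      rcases h0 with h0 | h0
      · exact hαa i hi j (by omega)
      · have := hαb i hi j
        simp only [Finsupp.coe_zero, Pi.zero_apply]
        omega
    have hs : s = {i} := by
      ext j
      rw [Finset.mem_singleton]
      exact ⟨fun hj => hinj j hj i hi (by rw [hz i hi, hz j hj]), fun hj => hj ▸ hi⟩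
    have := hrel 0 0
    rw [hs, Finset.sum_singleton, ← hself, hz i hi] at this
    simpa [K] using this
  push Not at h0
  have ha : 0 < a := Nat.pos_of_ne_zero h0.1
  have hb : 0 < b := Nat.pos_of_ne_zero h0.2
  have b0 : ∀ i ∈ s, β i 0 = b - α i (a - 1) := fun i hi => by
    simpa using hβv i hi 0 ha
  have bl : ∀ i ∈ s, β i (a - 1) = b - α i 0 := fun i hi => by
    simpa using hβv i hi (a - 1) (by omega)
  by_cases hfull : α i 0 = b
  · have hl := b0 i hi
    rw [← hself] at hl
    have hle := hαb i hi (a - 1)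
    have hl0 : α i (a - 1) = 0 := by omega
    have ha2 : 2 ≤ a := by
      by_contra hc
      have : a = 1 := by omega
      subst this
      simp at hl0
      omega
    have hr := hrel.row hα hβ b b (fun i hi => hαb i hi 0)
      (fun i hi => by rw [b0 i hi]; omega)
    refine ih (a - 2 + b) (by omega) (a - 2) b rfl _ g _ _ ?_ ?_ ?_ ?_ ?_ ?_ ?_ hr i ?_ ?_
    · intro k hk
      rw [Finset.mem_filter] at hk
      exact fun p q hpq => hα k hk.1 (Nat.succ_le_succ hpq)
    · intro k hk
      rw [Finset.mem_filter] at hk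
      exact fun p q hpq => hβ k hk.1 (Nat.succ_le_succ hpq)
    · intro k hk j
      rw [Finset.mem_filter] at hk
      exact hαb k hk.1 _
    · intro k hk j hj
      rw [Finset.mem_filter] at hk
      rw [sh_apply]
      have h1 := b0 k hk.1
      have h2 := hαb k hk.1 (a - 1)
      have h3 : α k (j + 1) ≤ α k (a - 1) := hα k hk.1 (by omega)
      omega
    · intro k hk j hj
      rw [Finset.mem_filter] at hk
      rw [sh_apply, sh_apply, hβv k hk.1 (j + 1) (by omega)]
      congr 2
      omega
    · intro k hk j hj
      rw [Finset.mem_filter] at hk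
      rw [sh_apply]
      have h1 := bl k hk.1
      have h3 : β k (j + 1) ≤ β k (a - 1) := hβ k hk.1 (by omega)
      omega
    · intro k hk k' hk' e
      rw [Finset.mem_filter] at hk hk'
      refine hinj k hk.1 k' hk'.1 ?_
      ext j
      cases j with
      | zero => rw [hk.2.1, hk'.2.1]
      | succ j => exact DFunLike.congr_fun e j
    · rw [Finset.mem_filter, ← hself]
      exact ⟨hi, hfull, hfull⟩
    · simp only [hself]
  · have hlt : α i 0 < b := lt_of_le_of_ne (hαb i hi 0) hfull
    have hl := bl i hi
    rw [← hself] at hl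
    have hmono : α i (a - 1) ≤ α i 0 := hα i hi (by omega)
    have hpos : ∀ j < a, 0 < α i j := by
      intro j hj
      have : α i (a - 1) ≤ α i j := hα i hi (by omega)
      omega
    have hb2 : 2 ≤ b := by omega
    have hr := hrel.col hα hβ a a hαa hβa
    refine ih (a + (b - 2)) (by omega) a (b - 2) rfl _ g _ _ ?_ ?_ ?_ ?_ ?_ ?_ ?_ hr i ?_ ?_
    · intro k hk
      rw [Finset.mem_filter] at hk
      exact co_antitone (hα k hk.1)
    · intro k hk
      rw [Finset.mem_filter] at hk
      exact co_antitone (hβ k hk.1)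
    · intro k hk j
      rw [Finset.mem_filter] at hk
      rw [co_apply]
      have h1 := bl k hk.1
      have h2 := hk.2.2 (a - 1) (by omega)
      have h3 : α k j ≤ α k 0 := hα k hk.1 (by omega)
      omega
    · intro k hk j hj
      rw [Finset.mem_filter] at hk
      rw [co_apply, hαa k hk.1 j hj]
    · intro k hk j hj
      rw [Finset.mem_filter] at hk
      rw [co_apply, co_apply, hβv k hk.1 j hj]
      have := hk.2.1 (a - 1 - j) (by omega)
      omega
    · intro k hk j hj
      rw [Finset.mem_filter] at hk
      rw [co_apply, hβa k hk.1 j hj]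
    · intro k hk k' hk' e
      rw [Finset.mem_filter] at hk hk'
      refine hinj k hk.1 k' hk'.1 ?_
      ext j
      have := DFunLike.congr_fun e j
      simp only [co_apply] at this
      by_cases hj : j < a
      · have h1 := hk.2.1 j hj
        have h2 := hk'.2.1 j hj
        omega
      · rw [hαa k hk.1 j (by omega), hαa k' hk'.1 j (by omega)]
    · rw [Finset.mem_filter, ← hself]
      exact ⟨hi, hpos, hpos⟩
    · simp only [hself]

end poly

/-! ## Part 2: the branching rule for the tableau definition -/

/-- the Young diagram of a partition given as a finitely supported function -/
def D (f : ℕ →₀ ℕ) : YoungDiagram :=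
  ⟨(f.support ×ˢ Finset.range (f.support.sup f)).filter fun c => ∀ i ≤ c.1, c.2 < f i, by
    rintro ⟨i, j⟩ ⟨i', j'⟩ ⟨hi, hj⟩ h
    simp only [Finset.coe_filter, Finset.mem_product, Finset.mem_range, Set.mem_ofPred_eq] at h hi hj ⊢
    have h2 : ∀ k ≤ i', j' < f k := fun k hk => lt_of_le_of_lt hj (h.2 k (hk.trans hi))
    exact ⟨⟨Finsupp.mem_support_iff.2 (by have := h2 i' le_rfl; omega),
      lt_of_le_of_lt hj h.1.2⟩, h2⟩⟩

/-- the diagram `M` has row lengths `f` -/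
def Shape (M : YoungDiagram) (f : ℕ →₀ ℕ) : Prop := ∀ i j, (i, j) ∈ M ↔ j < f i

lemma D_shape {f : ℕ →₀ ℕ} (hf : Antitone f) : Shape (D f) f := by
  intro i j
  change (i, j) ∈ (f.support ×ˢ Finset.range (f.support.sup f)).filter
    (fun c => ∀ i ≤ c.1, c.2 < f i) ↔ _
  rw [Finset.mem_filter, Finset.mem_product, Finset.mem_range]
  constructor
  · intro h
    exact h.2 i le_rfl
  · intro h
    have hi : i ∈ f.support := Finsupp.mem_support_iff.2 (by omega)
    exact ⟨⟨hi, lt_of_lt_of_le h (Finset.le_sup (f := f) hi)⟩, fun k hk => lt_of_lt_of_le h (hf hk)⟩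

lemma shape_card {M : YoungDiagram} {f : ℕ →₀ ℕ} (h : Shape M f) :
    M.cells.card = Finsupp.degree f := by
  have hr : ∀ i, M.rowLen i = f i := by
    intro i
    have : ∀ j, j < M.rowLen i ↔ j < f i := fun j => by
      rw [← YoungDiagram.mem_iff_lt_rowLen, h i j]
    have h1 := this (f i)
    have h2 := this (M.rowLen i)
    omega
  rw [Finset.card_eq_sum_card_fiberwise (f := Prod.fst) (t := f.support), Finsupp.degree_apply]
  · refine Finset.sum_congr rfl fun i _ => ?_
    rw [← hr i, YoungDiagram.rowLen_eq_card]
    rfl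
  · rintro ⟨i, j⟩ hc
    have : (i, j) ∈ M := hc
    rw [h i j] at this
    exact Finsupp.mem_support_iff.2 (by simp only; omega)

lemma lower_mem {P : Finset ℕ} (h : ∀ i j, i ≤ j → j ∈ P → i ∈ P) (j : ℕ) :
    j ∈ P ↔ j < P.card := by
  constructor
  · intro hj
    have : Finset.range (j + 1) ⊆ P := fun i hi => h i j (by simp at hi; omega) hj
    have := Finset.card_le_card this
    rw [Finset.card_range] at this
    omega
  · intro hj
    by_contra hc
    have : P ⊆ Finset.range j := by
      intro i hi
      rw [Finset.mem_range]
      by_contra hij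
      exact hc (h j i (by omega) hi)
    have := Finset.card_le_card this
    rw [Finset.card_range] at this
    omega

/-- the set of tableaux of weight `m` -/
def W (M : YoungDiagram) (m : ℕ →₀ ℕ) : Set (SemistandardYoungTableau M) :=
  {T | ∀ k : ℕ, (M.cells.filter fun c => T c.1 c.2 = k).card = m k}

lemma W_entry {M : YoungDiagram} {m : ℕ →₀ ℕ} {T : SemistandardYoungTableau M} (hT : T ∈ W M m)
    {i j : ℕ} (h : (i, j) ∈ M) : m (T i j) ≠ 0 := by
  rw [← hT (T i j)]
  rw [Finset.card_ne_zero]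
  exact ⟨(i, j), Finset.mem_filter.2 ⟨h, rfl⟩⟩

lemma W_finite (M : YoungDiagram) (m : ℕ →₀ ℕ) : (W M m).Finite := by
  rw [← Set.finite_coe_iff]
  let F : W M m → (M.cells → m.support) := fun T c =>
    ⟨T.1 c.1.1 c.1.2, Finsupp.mem_support_iff.2 (W_entry T.2 c.2)⟩
  refine Finite.of_injective F ?_
  intro T T' h
  apply Subtype.ext
  apply SemistandardYoungTableau.ext
  intro i j
  by_cases hc : (i, j) ∈ M
  · have := congrFun h ⟨(i, j), hc⟩
    exact congrArg Subtype.val this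
  · rw [T.1.zeros hc, T'.1.zeros hc]

/-- the shape of the entries `< n` -/
noncomputable def nu (f : ℕ →₀ ℕ) (n : ℕ) {M : YoungDiagram} (T : SemistandardYoungTableau M) :
    ℕ →₀ ℕ :=
  Finsupp.onFinset f.support (fun i => ((Finset.range (f i)).filter fun j => T i j < n).card) (by
    intro i hi
    rw [Finsupp.mem_support_iff]
    intro h0
    simp [h0] at hi)

lemma lt_nu {f : ℕ →₀ ℕ} {n : ℕ} {M : YoungDiagram} (hM : Shape M f)
    (T : SemistandardYoungTableau M) (i j : ℕ) : j < nu f n T i ↔ j < f i ∧ T i j < n := by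
  have := lower_mem (P := (Finset.range (f i)).filter fun j => T i j < n) (by
    intro p q hpq hq
    rw [Finset.mem_filter, Finset.mem_range] at hq ⊢
    exact ⟨by omega, lt_of_le_of_lt (T.row_weak_of_le hpq ((hM i q).2 hq.1)) hq.2⟩) j
  rw [Finset.mem_filter, Finset.mem_range] at this
  exact this.symm

/-- restriction of a tableau to a smaller shape -/
def restr {M N : YoungDiagram} (h : N ≤ M) (T : SemistandardYoungTableau M) :
    SemistandardYoungTableau N where
  entry i j := if (i, j) ∈ N then T i j else 0
  row_weak' := by
    intro i j1 j2 hj hm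
    rw [if_pos hm, if_pos (N.up_left_mem le_rfl hj.le hm)]
    exact T.row_weak hj (h hm)
  col_strict' := by
    intro i1 i2 j hi hm
    rw [if_pos hm, if_pos (N.up_left_mem hi.le le_rfl hm)]
    exact T.col_strict hi (h hm)
  zeros' := by
    intro i j hm
    rw [if_neg hm]

lemma restr_apply {M N : YoungDiagram} (h : N ≤ M) (T : SemistandardYoungTableau M) (i j : ℕ) :
    restr h T i j = if (i, j) ∈ N then T i j else 0 := rfl

/-- extension of a tableau by `n` on a horizontal strip -/
def exten {M N : YoungDiagram} (n : ℕ) (h : N ≤ M)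
    (hstrip : ∀ i j, (i + 1, j) ∈ M → (i, j) ∈ N)
    (T : SemistandardYoungTableau N) (hT : ∀ i j, (i, j) ∈ N → T i j < n) :
    SemistandardYoungTableau M where
  entry i j := if (i, j) ∈ N then T i j else if (i, j) ∈ M then n else 0
  row_weak' := by
    intro i j1 j2 hj hm
    by_cases h2 : (i, j2) ∈ N
    · rw [if_pos h2, if_pos (N.up_left_mem le_rfl hj.le h2)]
      exact T.row_weak hj h2
    · rw [if_neg h2, if_pos hm]
      split_ifs with h1 h3
      · exact (hT _ _ h1).le
      · exact le_rfl
      · exact Nat.zero_le _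
  col_strict' := by
    intro i1 i2 j hi hm
    obtain ⟨i2, rfl⟩ : ∃ k, i2 = k + 1 := ⟨i2 - 1, by omega⟩
    have h1 : (i1, j) ∈ N := N.up_left_mem (by omega) le_rfl (hstrip _ _ hm)
    rw [if_pos h1]
    split_ifs with h2
    · exact T.col_strict hi h2
    · exact hT _ _ h1
  zeros' := by
    intro i j hm
    rw [if_neg (fun hn => hm (h hn)), if_neg hm]

lemma exten_apply {M N : YoungDiagram} (n : ℕ) (h : N ≤ M)
    (hstrip : ∀ i j, (i + 1, j) ∈ M → (i, j) ∈ N)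
    (T : SemistandardYoungTableau N) (hT : ∀ i j, (i, j) ∈ N → T i j < n) (i j : ℕ) :
    exten n h hstrip T hT i j = if (i, j) ∈ N then T i j else if (i, j) ∈ M then n else 0 := rfl

lemma nu_mem {f m : ℕ →₀ ℕ} {n : ℕ} {M : YoungDiagram} (hM : Shape M f)
    (hm : ∀ k, n < k → m k = 0) {T : SemistandardYoungTableau M} (hT : T ∈ W M m) :
    nu f n T ∈ hs f := by
  rw [mem_hs]
  constructor
  · intro i
    by_contra hc
    have := (lt_nu (n := n) hM T i (f i)).1 (by omega)
    omega
  · intro i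
    by_contra hc
    have h1 : (i + 1, nu f n T i) ∈ M := (hM _ _).2 (by omega)
    have h2 := T.col_strict (Nat.lt_succ_self i) h1
    have h3 : T (i + 1) (nu f n T i) ≤ n := by
      by_contra h4
      exact W_entry hT h1 (hm _ (by omega))
    have h4 : (i, nu f n T i) ∈ M := M.up_left_mem (Nat.le_succ i) le_rfl h1
    have := (lt_nu (n := n) hM T i (nu f n T i)).2 ⟨(hM _ _).1 h4, lt_of_lt_of_le h2 h3⟩
    omega

/-- counting letters of an extended filling -/
lemma count_split {M N : YoungDiagram} (h : N ≤ M) (t : ℕ → ℕ → ℕ) (n k : ℕ)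
    (hN : ∀ i j, (i, j) ∈ N → t i j < n) (hMN : ∀ i j, (i, j) ∈ M → (i, j) ∉ N → t i j = n) :
    (k ≠ n → (M.cells.filter fun c => t c.1 c.2 = k).card =
      (N.cells.filter fun c => t c.1 c.2 = k).card) ∧
    (k = n → (M.cells.filter fun c => t c.1 c.2 = k).card = M.cells.card - N.cells.card) := by
  constructor
  · intro hk
    congr 1
    ext ⟨i, j⟩
    simp only [Finset.mem_filter, YoungDiagram.mem_cells]
    constructor
    · rintro ⟨h1, h2⟩
      refine ⟨?_, h2⟩
      by_contra h3
      exact hk (h2.symm.trans (hMN _ _ h1 h3))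
    · rintro ⟨h1, h2⟩
      exact ⟨h h1, h2⟩
  · rintro rfl
    rw [← Finset.card_sdiff_of_subset (YoungDiagram.cells_subset_iff.2 h)]
    congr 1
    ext ⟨i, j⟩
    simp only [Finset.mem_filter, Finset.mem_sdiff, YoungDiagram.mem_cells]
    constructor
    · rintro ⟨h1, h2⟩
      refine ⟨h1, fun h3 => ?_⟩
      have := hN _ _ h3
      omega
    · rintro ⟨h1, h2⟩
      exact ⟨h1, hMN _ _ h1 h2⟩

lemma fiber_card {f m ν : ℕ →₀ ℕ} {n : ℕ} {M : YoungDiagram} (hM : Shape M f)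
    (hm : ∀ k, n < k → m k = 0) (hν : ν ∈ hs f) :
    {T | T ∈ W M m ∧ nu f n T = ν}.ncard =
      if Finsupp.degree (f - ν) = m n then (W (D ν) (m.erase n)).ncard else 0 := by
  have hD := D_shape (hs_antitone hν)
  have hν' := mem_hs.1 hν
  have hle : D ν ≤ M := by
    rintro ⟨i, j⟩ h
    have := (hD i j).1 h
    exact (hM i j).2 (lt_of_lt_of_le this (hν'.1 i))
  have hstrip : ∀ i j, (i + 1, j) ∈ M → (i, j) ∈ D ν := fun i j h =>
    (hD i j).2 (lt_of_lt_of_le ((hM _ _).1 h) (hν'.2 i))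
  have hcard : M.cells.card - (D ν).cells.card = Finsupp.degree (f - ν) := by
    rw [shape_card hM, shape_card hD]
    have := deg_sub hν'.1
    omega
  have fact1 : ∀ T ∈ {T | T ∈ W M m ∧ nu f n T = ν}, ∀ i j, (i, j) ∈ D ν → T i j < n := by
    rintro T ⟨hT, rfl⟩ i j h
    exact ((lt_nu hM T i j).1 ((hD i j).1 h)).2
  have fact2 : ∀ T ∈ {T | T ∈ W M m ∧ nu f n T = ν}, ∀ i j, (i, j) ∈ M → (i, j) ∉ D ν →
      T i j = n := by
    rintro T ⟨hT, rfl⟩ i j h hn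
    have h1 : ¬ T i j < n := fun hlt =>
      hn ((hD i j).2 ((lt_nu hM T i j).2 ⟨(hM i j).1 h, hlt⟩))
    have h2 : ¬ n < T i j := fun hlt => W_entry hT h (hm _ hlt)
    omega
  split_ifs with hd
  · refine Set.ncard_congr (fun T _ => restr hle T) ?_ ?_ ?_
    · intro T hT k
      have hc := count_split hle (fun i j => T i j) n k (fact1 T hT) (fact2 T hT)
      have e : ((D ν).cells.filter fun c => restr hle T c.1 c.2 = k) =
          (D ν).cells.filter fun c => T c.1 c.2 = k := by
        refine Finset.filter_congr fun c hc => ?_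
        rw [restr_apply, if_pos (show (c.1, c.2) ∈ D ν from hc)]
      rw [e]
      by_cases hk : k = n
      · subst hk
        rw [Finsupp.erase_same, Finset.card_eq_zero, Finset.filter_eq_empty_iff]
        intro c hc
        have := fact1 T hT c.1 c.2 hc
        omega
      · rw [Finsupp.erase_ne hk, ← hT.1 k]
        exact (hc.1 hk).symm
    · intro T T' hT hT' h
      apply SemistandardYoungTableau.ext
      intro i j
      by_cases h1 : (i, j) ∈ D ν
      · have := congrArg (fun S : SemistandardYoungTableau (D ν) => S i j) h
        simpa only [restr_apply, if_pos h1] using this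
      · by_cases h2 : (i, j) ∈ M
        · rw [fact2 T hT i j h2 h1, fact2 T' hT' i j h2 h1]
        · rw [T.zeros h2, T'.zeros h2]
    · intro T hT
      have hlt : ∀ i j, (i, j) ∈ D ν → T i j < n := by
        intro i j h
        have h1 := W_entry hT h
        by_contra hc
        rcases eq_or_lt_of_le (not_lt.1 hc) with he | hl
        · rw [← he, Finsupp.erase_same] at h1
          exact h1 rfl
        · rw [Finsupp.erase_ne (by omega), hm _ hl] at h1
          exact h1 rfl
      refine ⟨exten n hle hstrip T hlt, ⟨?_, ?_⟩, ?_⟩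
      · intro k
        have hc := count_split hle (fun i j => exten n hle hstrip T hlt i j) n k
          (fun i j h => by simp only [exten_apply]; rw [if_pos h]; exact hlt i j h)
          (fun i j h h' => by simp only [exten_apply]; rw [if_neg h', if_pos h])
        by_cases hk : k = n
        · refine (hc.2 hk).trans ?_
          rw [hcard, hd, hk]
        · refine (hc.1 hk).trans ?_
          have := hT k
          rw [Finsupp.erase_ne hk] at this
          rw [← this]
          congr 1
          refine Finset.filter_congr fun c hc => ?_
          rw [exten_apply, if_pos (show (c.1, c.2) ∈ D ν from hc)]
      · ext i
        have : ∀ j, j < nu f n (exten n hle hstrip T hlt) i ↔ j < ν i := by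
          intro j
          rw [lt_nu hM, exten_apply, ← hM i j, ← hD i j]
          constructor
          · rintro ⟨h1, h2⟩
            by_contra h3
            rw [if_neg h3, if_pos h1] at h2
            omega
          · intro h1
            rw [if_pos h1]
            exact ⟨hle h1, hlt _ _ h1⟩
        have h1 := this (ν i)
        have h2 := this (nu f n (exten n hle hstrip T hlt) i)
        omega
      · apply SemistandardYoungTableau.ext
        intro i j
        rw [restr_apply, exten_apply]
        split_ifs with h
        · rfl
        · rw [T.zeros h]
  · rw [Set.ncard_eq_zero ((W_finite M m).subset fun T hT => hT.1), Set.eq_empty_iff_forall_notMem]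
    intro T hT
    have hc := count_split hle (fun i j => T i j) n n (fact1 T hT) (fact2 T hT)
    have := hT.1 n
    rw [hc.2 rfl, hcard] at this
    exact hd this

lemma W_step {f m : ℕ →₀ ℕ} {n : ℕ} {M : YoungDiagram} (hM : Shape M f)
    (hm : ∀ k, n < k → m k = 0) :
    (W M m).ncard = ∑ ν ∈ hs f,
      if Finsupp.degree (f - ν) = m n then (W (D ν) (m.erase n)).ncard else 0 := by
  rw [Set.ncard_eq_toFinset_card _ (W_finite M m),
    Finset.card_eq_sum_card_fiberwise (f := nu f n) (t := hs f)]
  · refine Finset.sum_congr rfl fun ν hν => ?_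
    rw [← fiber_card hM hm hν, ← Set.ncard_coe_finset]
    congr 1
    ext T
    simp
  · intro T hT
    exact nu_mem hM hm (by simpa using hT)

open MvPolynomial in
lemma K_coeff_zero (n : ℕ) (f m : ℕ →₀ ℕ) (k : ℕ) (hk : n ≤ k) (hmk : m k ≠ 0) :
    coeff m (K (X : ℕ → MvPolynomial ℕ ℚ) n f) = 0 := by
  induction n generalizing f m with
  | zero =>
    simp only [K]
    split_ifs
    · rw [coeff_one, if_neg]
      rintro rfl
      exact hmk rfl
    · rfl
  | succ n ih =>
    simp only [K, coeff_sum, X_pow_eq_monomial, coeff_monomial_mul']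
    refine Finset.sum_eq_zero fun ν _ => ?_
    split_ifs
    · rw [ih ν _ (by omega), mul_zero]
      simpa [Finsupp.single_apply, show n ≠ k by omega] using hmk
    · rfl

open MvPolynomial in
lemma K_coeff (n : ℕ) (f m : ℕ →₀ ℕ) (hf : Antitone f) (M : YoungDiagram) (hM : Shape M f)
    (hm : ∀ k, n ≤ k → m k = 0) :
    coeff m (K (X : ℕ → MvPolynomial ℕ ℚ) n f) = ((W M m).ncard : ℚ) := by
  induction n generalizing f m M with
  | zero =>
    have hm0 : m = 0 := by ext k; exact hm k (Nat.zero_le k)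
    subst hm0
    simp only [K]
    split_ifs with h0
    · subst h0
      have : W M 0 = {SemistandardYoungTableau.highestWeight M} := by
        have hno : ∀ i j, (i, j) ∉ M := fun i j h => by simpa using (hM i j).1 h
        ext T
        rw [Set.mem_singleton_iff]
        constructor
        · intro _
          apply SemistandardYoungTableau.ext
          intro i j
          rw [T.zeros (hno i j), SemistandardYoungTableau.zeros _ (hno i j)]
        · intro _ k
          rw [Finsupp.coe_zero, Pi.zero_apply, Finset.card_eq_zero, Finset.filter_eq_empty_iff]
          intro c hc
          exact absurd hc (hno c.1 c.2)
      rw [this]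
      simp
    · have : W M 0 = ∅ := by
        rw [Set.eq_empty_iff_forall_notMem]
        intro T hT
        apply h0
        ext i
        by_contra hc
        exact W_entry hT ((hM i 0).2 (Nat.pos_of_ne_zero hc)) rfl
      rw [this]
      simp
  | succ n ih =>
    rw [W_step hM (fun k hk => hm k hk)]
    simp only [K, coeff_sum, X_pow_eq_monomial, coeff_monomial_mul', Nat.cast_sum]
    refine Finset.sum_congr rfl fun ν hν => ?_
    by_cases hd : Finsupp.degree (f - ν) = m n
    · rw [if_pos hd, if_pos (by rw [Finsupp.single_le_iff, hd]), one_mul]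
      have e : m - Finsupp.single n (Finsupp.degree (f - ν)) = m.erase n := by
        ext k
        by_cases hk : k = n
        · subst hk; simp [hd]
        · simp [Finsupp.erase_ne hk, Finsupp.single_apply, Ne.symm hk]
      rw [e]
      refine ih ν _ (hs_antitone hν) (D ν) (D_shape (hs_antitone hν)) ?_
      intro k hk
      by_cases hkn : k = n
      · subst hkn; simp
      · rw [Finsupp.erase_ne hkn]; exact hm k (by omega)
    · rw [if_neg hd]
      split_ifs with hle
      · rw [Finsupp.single_le_iff] at hle
        rw [K_coeff_zero n ν _ n le_rfl]
        · simp
        · simp only [Finsupp.coe_tsub, Pi.sub_apply, Finsupp.single_eq_same]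
          omega
      · simp

/-- row lengths as a finitely supported function -/
noncomputable def rw' (M : YoungDiagram) : ℕ →₀ ℕ :=
  Finsupp.onFinset (Finset.range (M.colLen 0)) M.rowLen (by
    intro i hi
    rw [Finset.mem_range, ← YoungDiagram.mem_iff_lt_colLen, YoungDiagram.mem_iff_lt_rowLen]
    omega)

lemma rw'_apply (M : YoungDiagram) (i : ℕ) : rw' M i = M.rowLen i := rfl

lemma rw'_shape (M : YoungDiagram) : Shape M (rw' M) := fun i j => by
  rw [rw'_apply, YoungDiagram.mem_iff_lt_rowLen]

lemma rw'_anti (M : YoungDiagram) : Antitone (rw' M) := fun i j h => M.rowLen_anti i j h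

lemma rw'_inj {M N : YoungDiagram} (h : rw' M = rw' N) : M = N := by
  apply SetLike.ext
  rintro ⟨i, j⟩
  rw [rw'_shape M, rw'_shape N, h]

open MvPolynomial in
lemma K_schur (n : ℕ) (m : ℕ →₀ ℕ) (M : YoungDiagram) (hm : ∀ k, n ≤ k → m k = 0) :
    coeff m (K (X : ℕ → MvPolynomial ℕ ℚ) n (rw' M)) = MvPowerSeries.coeff m (schur M) :=
  K_coeff n (rw' M) m (rw'_anti M) M (rw'_shape M) hm

lemma rel_of_schur {s : Finset YoungDiagram} {g : YoungDiagram → ℚ}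
    {c : YoungDiagram → YoungDiagram}
    (h : ∑ μ ∈ s, g μ • (schur μ * schur (c μ)) = 0) :
    Rel s g (fun μ => rw' μ) (fun μ => rw' (c μ)) := by
  intro n x
  have key : ∑ μ ∈ s, MvPolynomial.C (g μ) * (K (MvPolynomial.X : ℕ → MvPolynomial ℕ ℚ) n (rw' μ) *
      K MvPolynomial.X n (rw' (c μ))) = 0 := by
    ext m
    rw [MvPolynomial.coeff_sum, MvPolynomial.coeff_zero]
    simp only [MvPolynomial.coeff_C_mul]
    by_cases hm : ∀ k, n ≤ k → m k = 0
    · have h1 := congrArg (MvPowerSeries.coeff m) h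
      rw [map_sum, map_zero] at h1
      refine Eq.trans ?_ h1
      refine Finset.sum_congr rfl fun μ _ => ?_
      rw [map_smul, smul_eq_mul, MvPowerSeries.coeff_mul, MvPolynomial.coeff_mul]
      congr 1
      refine Finset.sum_congr rfl fun p hp => ?_
      rw [Finset.HasAntidiagonal.mem_antidiagonal] at hp
      have hp' : ∀ k, p.1 k + p.2 k = m k := fun k => by rw [← hp]; rfl
      rw [K_schur, K_schur]
      · intro k hk
        have := hp' k
        have := hm k hk
        omega
      · intro k hk
        have := hp' k
        have := hm k hk
        omega
    · push Not at hm
      obtain ⟨k, hk, hmk⟩ := hm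
      refine Finset.sum_eq_zero fun μ _ => ?_
      rw [MvPolynomial.coeff_mul]
      refine mul_eq_zero_of_right _ (Finset.sum_eq_zero ?_)
      intro p hp
      rw [Finset.HasAntidiagonal.mem_antidiagonal] at hp
      have hp' : p.1 k + p.2 k = m k := by rw [← hp]; rfl
      by_cases h1 : p.1 k = 0
      · rw [K_coeff_zero n _ p.2 k hk (by omega), mul_zero]
      · rw [K_coeff_zero n _ p.1 k hk h1, zero_mul]
  have h2 := congrArg (MvPolynomial.eval x) key
  rw [map_sum, map_zero] at h2
  refine Eq.trans ?_ h2
  refine Finset.sum_congr rfl fun μ _ => ?_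
  rw [map_mul, map_mul, K_map, K_map]
  simp

lemma mem_rect {a b i j : ℕ} : (i, j) ∈ rect a b ↔ i < a ∧ j < b := by
  change (i, j) ∈ Finset.range a ×ˢ Finset.range b ↔ _
  simp

lemma mem_rectCompl {a b i j : ℕ} {μ : YoungDiagram} :
    (i, j) ∈ rectCompl a b μ ↔ (i < a ∧ j < b) ∧ (a - 1 - i, b - 1 - j) ∉ μ := by
  change (i, j) ∈ (rect a b).cells.filter (fun c => (a - 1 - c.1, b - 1 - c.2) ∉ μ) ↔ _
  rw [Finset.mem_filter, YoungDiagram.mem_cells, mem_rect]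

lemma rowLen_compl {a b i : ℕ} {μ : YoungDiagram} (hi : i < a) :
    (rectCompl a b μ).rowLen i = b - μ.rowLen (a - 1 - i) := by
  have : ∀ j, j < (rectCompl a b μ).rowLen i ↔ j < b - μ.rowLen (a - 1 - i) := by
    intro j
    rw [← YoungDiagram.mem_iff_lt_rowLen, mem_rectCompl, YoungDiagram.mem_iff_lt_rowLen]
    omega
  have h1 := this (b - μ.rowLen (a - 1 - i))
  have h2 := this ((rectCompl a b μ).rowLen i)
  omega

lemma rowLen_compl_zero {a b i : ℕ} {μ : YoungDiagram} (hi : a ≤ i) :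
    (rectCompl a b μ).rowLen i = 0 := by
  by_contra hc
  have : (i, 0) ∈ rectCompl a b μ := YoungDiagram.mem_iff_lt_rowLen.2 (by omega)
  rw [mem_rectCompl] at this
  omega

end SqInd

/-- Fix an `a × b` rectangle `R` with `a, b > 0`.  If a rational linear
combination of the products `s_μ ⬝ s_{μᶜ}` over unordered complementary pairs `{μ, μᶜ}` in
`R` vanishes (encoded by a finitely supported symmetric coefficient function `g`), then the
coefficient of every self-complementary square `s_lam²` is zero. -/
theorem statement2 (a b : ℕ) (ha : 0 < a) (hb : 0 < b) (g : YoungDiagram →₀ ℚ)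
    (hsupp : ∀ μ ∈ g.support, μ ≤ rect a b)
    (hsym : ∀ μ : YoungDiagram, μ ≤ rect a b → g (rectCompl a b μ) = g μ)
    (hzero : (g.sum fun μ q => q • (schur μ * schur (rectCompl a b μ))) = 0) :
    ∀ lam : YoungDiagram, lam ≤ rect a b → rectCompl a b lam = lam → g lam = 0 := by
  intro lam _ hself
  by_contra hne
  have hrow : ∀ μ ∈ g.support, ∀ i j, j < μ.rowLen i → i < a ∧ j < b := by
    intro μ hμ i j h
    exact SqInd.mem_rect.1 (hsupp μ hμ (YoungDiagram.mem_iff_lt_rowLen.2 h))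
  refine hne (SqInd.main (a + b) a b rfl g.support g (fun μ => SqInd.rw' μ)
    (fun μ => SqInd.rw' (rectCompl a b μ)) (fun μ _ => SqInd.rw'_anti _)
    (fun μ _ => SqInd.rw'_anti _) ?_ ?_ ?_ ?_ ?_ (SqInd.rel_of_schur hzero) lam
    (Finsupp.mem_support_iff.2 hne) (by simp only [hself]))
  · intro μ hμ j
    rw [SqInd.rw'_apply]
    by_contra hc
    have := hrow μ hμ j b (by omega)
    omega
  · intro μ hμ j hj
    rw [SqInd.rw'_apply]
    by_contra hc
    have := hrow μ hμ j 0 (by omega)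
    omega
  · intro μ _ j hj
    exact SqInd.rowLen_compl hj
  · intro μ _ j hj
    exact SqInd.rowLen_compl_zero hj
  · intro μ _ μ' _ h
    exact SqInd.rw'_inj h
end

section
/- Let a = 2c and b = 2d be even positive integers, R = (b^a), and let w be any word of length c+d in the letters h and v with exactly c h's and d v's. Let λ be the maximal element, in the w-ordering, of the set of self-complementary partitions contained in R, and let π be the partition whose w-notation satisfies π^w_i = 2·λ^w_i for all i. Then for every partition μ ⊆ R, the Littlewood–Richardson coefficient c^π_{μ, μ^c} is nonzero if and only if μ = λ. -/
open scoped Classical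

namespace LRAux

theorem mem_stripRow (μ : YoungDiagram) (i j : ℕ) : (i, j) ∈ stripRow μ ↔ (i + 1, j) ∈ μ := by
  rw [← YoungDiagram.mem_cells]
  simp only [stripRow, Finset.mem_image, Finset.mem_filter, Prod.exists, Prod.mk.injEq,
    YoungDiagram.mem_cells]
  constructor
  · rintro ⟨x, y, ⟨h, hx⟩, h1, rfl⟩
    obtain rfl : x = i + 1 := by omega
    exact h
  · intro h
    exact ⟨i + 1, j, ⟨h, by omega⟩, by omega, rfl⟩

theorem mem_stripCol (μ : YoungDiagram) (i j : ℕ) : (i, j) ∈ stripCol μ ↔ (i, j + 1) ∈ μ := by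
  simp [stripCol, YoungDiagram.mem_transpose, mem_stripRow]

theorem mem_rect (a b i j : ℕ) : (i, j) ∈ rect a b ↔ i < a ∧ j < b := by
  rw [← YoungDiagram.mem_cells]
  simp [rect]

theorem mem_compl (a b : ℕ) (μ : YoungDiagram) (i j : ℕ) :
    (i, j) ∈ rectCompl a b μ ↔ (i < a ∧ j < b) ∧ (a - 1 - i, b - 1 - j) ∉ μ := by
  rw [← mem_rect, ← YoungDiagram.mem_cells]
  simp [rectCompl]

theorem yd_ext {μ ν : YoungDiagram} (h : ∀ i j, (i, j) ∈ μ ↔ (i, j) ∈ ν) : μ = ν := by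
  apply YoungDiagram.ext
  ext ⟨i, j⟩
  simpa using h i j

theorem yd_le {μ ν : YoungDiagram} : μ ≤ ν ↔ ∀ i j, (i, j) ∈ μ → (i, j) ∈ ν :=
  ⟨fun h i j hm => h hm, fun h x hx => h x.1 x.2 hx⟩

theorem mem_row (μ : YoungDiagram) (i j : ℕ) : (i, j) ∈ μ ↔ j < μ.rowLen i :=
  YoungDiagram.mem_iff_lt_rowLen

theorem mem_col (μ : YoungDiagram) (i j : ℕ) : (i, j) ∈ μ ↔ i < μ.colLen j :=
  YoungDiagram.mem_iff_lt_colLen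

theorem eq_of_lt {x y : ℕ} (h : ∀ j, j < x ↔ j < y) : x = y := by
  have h1 := h x
  have h2 := h y
  omega

theorem rowLen_stripRow (μ : YoungDiagram) (i : ℕ) : (stripRow μ).rowLen i = μ.rowLen (i + 1) := by
  apply eq_of_lt
  intro j
  rw [← mem_row, ← mem_row, mem_stripRow]

theorem colLen_stripRow (μ : YoungDiagram) (j : ℕ) : (stripRow μ).colLen j = μ.colLen j - 1 := by
  apply eq_of_lt
  intro i
  rw [← mem_col, mem_stripRow, mem_col]
  omega

theorem colLen_stripCol (μ : YoungDiagram) (j : ℕ) : (stripCol μ).colLen j = μ.colLen (j + 1) := by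
  apply eq_of_lt
  intro i
  rw [← mem_col, ← mem_col, mem_stripCol]

theorem rowLen_stripCol (μ : YoungDiagram) (i : ℕ) : (stripCol μ).rowLen i = μ.rowLen i - 1 := by
  apply eq_of_lt
  intro j
  rw [← mem_row, mem_stripCol, mem_row]
  omega

theorem mem_skew (π μ : YoungDiagram) (i j : ℕ) :
    (i, j) ∈ π.cells \ μ.cells ↔ (i, j) ∈ π ∧ (i, j) ∉ μ := by
  simp

theorem skew_row (π μ : YoungDiagram) (i j : ℕ) :
    (i, j) ∈ (stripRow π).cells \ (stripRow μ).cells ↔ (i + 1, j) ∈ π.cells \ μ.cells := by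
  simp only [mem_skew, mem_stripRow]

theorem skew_col (π μ : YoungDiagram) (i j : ℕ) :
    (i, j) ∈ (stripCol π).cells \ (stripCol μ).cells ↔ (i, j + 1) ∈ π.cells \ μ.cells := by
  simp only [mem_skew, mem_stripCol]

theorem split_row (π μ : YoungDiagram) (P : ℕ × ℕ → Prop) [DecidablePred P] :
    ((π.cells \ μ.cells).filter P).card =
      ((Finset.range (π.rowLen 0)).filter fun j => μ.rowLen 0 ≤ j ∧ P (0, j)).card +
      (((stripRow π).cells \ (stripRow μ).cells).filter fun c => P (c.1 + 1, c.2)).card := by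
  rw [← Finset.card_image_of_injective
      ((Finset.range (π.rowLen 0)).filter fun j => μ.rowLen 0 ≤ j ∧ P (0, j))
      (f := fun j => ((0 : ℕ), j)) (by intro a b h; simpa using h),
    ← Finset.card_image_of_injective
      (((stripRow π).cells \ (stripRow μ).cells).filter fun c => P (c.1 + 1, c.2))
      (f := fun c : ℕ × ℕ => (c.1 + 1, c.2))
      (by rintro ⟨a, b⟩ ⟨a', b'⟩ h; simpa using h), ← Finset.card_union_of_disjoint]
  · congr 1
    ext ⟨i, j⟩
    rw [Finset.mem_filter, Finset.mem_union, Finset.mem_image, Finset.mem_image]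
    constructor
    · rintro ⟨h1, h2⟩
      rcases i with _ | i
      · left
        rw [mem_skew, mem_row, mem_row] at h1
        exact ⟨j, by simp only [Finset.mem_filter, Finset.mem_range]; exact ⟨h1.1, by omega, h2⟩, rfl⟩
      · right
        exact ⟨(i, j), by rw [Finset.mem_filter, skew_row]; exact ⟨h1, h2⟩, rfl⟩
    · rintro (⟨j', h, he⟩ | ⟨⟨i', j'⟩, h, he⟩)
      · simp only [Prod.mk.injEq] at he
        obtain ⟨rfl, rfl⟩ := he
        simp only [Finset.mem_filter, Finset.mem_range] at h
        rw [mem_skew, mem_row, mem_row]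
        exact ⟨⟨h.1, by omega⟩, h.2.2⟩
      · simp only [Prod.mk.injEq] at he
        obtain ⟨rfl, rfl⟩ := he
        rw [Finset.mem_filter, skew_row] at h
        exact h
  · rw [Finset.disjoint_left]
    intro x hx hy
    simp only [Finset.mem_image] at hx hy
    obtain ⟨j, _, rfl⟩ := hx
    obtain ⟨c, _, h⟩ := hy
    simp at h

theorem split_col (π μ : YoungDiagram) (P : ℕ × ℕ → Prop) [DecidablePred P] :
    ((π.cells \ μ.cells).filter P).card =
      ((Finset.range (π.colLen 0)).filter fun i => μ.colLen 0 ≤ i ∧ P (i, 0)).card +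
      (((stripCol π).cells \ (stripCol μ).cells).filter fun c => P (c.1, c.2 + 1)).card := by
  rw [← Finset.card_image_of_injective
      ((Finset.range (π.colLen 0)).filter fun i => μ.colLen 0 ≤ i ∧ P (i, 0))
      (f := fun i => (i, (0 : ℕ))) (by intro a b h; simpa using h),
    ← Finset.card_image_of_injective
      (((stripCol π).cells \ (stripCol μ).cells).filter fun c => P (c.1, c.2 + 1))
      (f := fun c : ℕ × ℕ => (c.1, c.2 + 1))
      (by rintro ⟨a, b⟩ ⟨a', b'⟩ h; simpa using h), ← Finset.card_union_of_disjoint]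
  · congr 1
    ext ⟨i, j⟩
    rw [Finset.mem_filter, Finset.mem_union, Finset.mem_image, Finset.mem_image]
    constructor
    · rintro ⟨h1, h2⟩
      rcases j with _ | j
      · left
        rw [mem_skew, mem_col, mem_col] at h1
        exact ⟨i, by simp only [Finset.mem_filter, Finset.mem_range]; exact ⟨h1.1, by omega, h2⟩, rfl⟩
      · right
        exact ⟨(i, j), by rw [Finset.mem_filter, skew_col]; exact ⟨h1, h2⟩, rfl⟩
    · rintro (⟨j', h, he⟩ | ⟨⟨i', j'⟩, h, he⟩)
      · simp only [Prod.mk.injEq] at he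
        obtain ⟨rfl, rfl⟩ := he
        simp only [Finset.mem_filter, Finset.mem_range] at h
        rw [mem_skew, mem_col, mem_col]
        exact ⟨⟨h.1, by omega⟩, h.2.2⟩
      · simp only [Prod.mk.injEq] at he
        obtain ⟨rfl, rfl⟩ := he
        rw [Finset.mem_filter, skew_col] at h
        exact h
  · rw [Finset.disjoint_left]
    intro x hx hy
    simp only [Finset.mem_image] at hx hy
    obtain ⟨j, _, rfl⟩ := hx
    obtain ⟨c, _, h⟩ := hy
    simp at h

section filling
variable {π μ ν : YoungDiagram}

theorem row_mono (T : LRFilling π μ ν) (i j t : ℕ) (h : (i, j) ∈ π.cells \ μ.cells)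
    (h' : (i, j + t) ∈ π.cells \ μ.cells) : T.entry i j ≤ T.entry i (j + t) := by
  induction t with
  | zero => simp
  | succ t ih =>
    have hm : (i, j + t) ∈ π.cells \ μ.cells := by
      simp only [mem_skew, mem_row] at h h' ⊢
      omega
    exact (ih hm).trans (T.row_weak i (j + t) hm h')

theorem col_mono (T : LRFilling π μ ν) (i j t : ℕ) (h : (i, j) ∈ π.cells \ μ.cells)
    (h' : (i + t, j) ∈ π.cells \ μ.cells) : T.entry i j + t ≤ T.entry (i + t) j := by
  induction t with
  | zero => simp
  | succ t ih =>
    have hm : (i + t, j) ∈ π.cells \ μ.cells := by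
      simp only [mem_skew, mem_col] at h h' ⊢
      omega
    have := T.col_strict (i + t) j hm h'
    have := ih hm
    rw [← add_assoc i t 1]
    omega

theorem entry_lt (T : LRFilling π μ ν) (i j : ℕ) (h : (i, j) ∈ π.cells \ μ.cells) : T.entry i j < ν.colLen 0 := by
  rw [← mem_col, mem_row, ← T.content, Finset.card_pos]
  exact ⟨(i, j), Finset.mem_filter.2 ⟨h, rfl⟩⟩

theorem entry_ge (T : LRFilling π μ ν) (m i j : ℕ) (hm : (m, j) ∉ μ) (h : (i, j) ∈ π.cells \ μ.cells) :
    i - m ≤ T.entry i j := by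
  by_cases hi : m ≤ i
  · obtain ⟨t, rfl⟩ := Nat.exists_eq_add_of_le hi
    have : (m, j) ∈ π.cells \ μ.cells := by
      simp only [mem_skew, mem_col] at h hm ⊢
      omega
    have := col_mono T m j t this h
    omega
  · omega

theorem row_zero (T : LRFilling π μ ν) (j : ℕ) (h : (0, j) ∈ π.cells \ μ.cells) : T.entry 0 j = 0 := by
  by_contra hne
  obtain ⟨k, hk⟩ := Nat.exists_eq_succ_of_ne_zero hne
  have h1 := T.lattice 0 j k
  have h2 : 0 < ((π.cells \ μ.cells).filter fun c =>
        (c.1 < 0 ∨ (c.1 = 0 ∧ j ≤ c.2)) ∧ T.entry c.1 c.2 = k + 1).card :=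
    Finset.card_pos.2 ⟨(0, j), Finset.mem_filter.2 ⟨h, by simp, hk⟩⟩
  obtain ⟨⟨i', j'⟩, hc⟩ := Finset.card_pos.1 (h2.trans_le h1)
  rw [Finset.mem_filter] at hc
  obtain ⟨hc1, hc2, hc3⟩ := hc
  simp only [Nat.not_lt_zero, false_or] at hc2
  obtain ⟨rfl, hj⟩ := hc2
  obtain ⟨t, rfl⟩ := Nat.exists_eq_add_of_le hj
  have := row_mono T 0 j t h hc1
  simp only at hc3
  omega

theorem finite_LR : Finite (LRFilling π μ ν) := by
  have hb : ∀ (T : LRFilling π μ ν) (i j : ℕ), T.entry i j < ν.colLen 0 + 1 := by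
    intro T i j
    by_cases h : (i, j) ∈ π.cells \ μ.cells
    · have := entry_lt T i j h
      omega
    · rw [T.zeros i j h]
      omega
  refine Finite.of_injective (fun (T : LRFilling π μ ν) => fun c : π.cells =>
    (⟨T.entry c.1.1 c.1.2, hb T _ _⟩ : Fin (ν.colLen 0 + 1))) ?_
  intro T S h
  have : T.entry = S.entry := by
    funext i j
    by_cases hm : (i, j) ∈ π.cells
    · have := congrFun h ⟨(i, j), hm⟩
      simpa using this
    · have hm' : (i, j) ∉ π.cells \ μ.cells := fun h => hm (Finset.mem_sdiff.1 h).1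
      rw [T.zeros i j hm', S.zeros i j hm']
  cases T
  cases S
  congr

theorem row_part : ((Finset.range (π.rowLen 0)).filter fun j =>
    μ.rowLen 0 ≤ j ∧ True).card = π.rowLen 0 - μ.rowLen 0 := by
  rw [← Nat.card_Ico]
  congr 1
  ext j
  simp [and_comm]

theorem zero_count (T : LRFilling π μ ν) : ν.rowLen 0 = (π.rowLen 0 - μ.rowLen 0) +
    (((stripRow π).cells \ (stripRow μ).cells).filter fun c => T.entry (c.1 + 1) c.2 = 0).card := by
  rw [← T.content 0, split_row π μ, ← row_part]
  congr 2
  apply Finset.filter_congr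
  intro j hj
  simp only [and_congr_right_iff]
  intro h
  have : (0, j) ∈ π.cells \ μ.cells := by
    rw [mem_skew, mem_row, mem_row]
    simp at hj
    omega
  simpa using row_zero T j this

theorem row_le (T : LRFilling π μ ν) : π.rowLen 0 ≤ μ.rowLen 0 + ν.rowLen 0 := by
  have := zero_count T
  omega

theorem col_le (T : LRFilling π μ ν) : π.colLen 0 ≤ μ.colLen 0 + ν.colLen 0 := by
  by_contra h
  have hm : (π.colLen 0 - 1, 0) ∈ π.cells \ μ.cells := by
    simp only [mem_skew, mem_col]
    omega
  have h1 := entry_lt T _ _ hm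
  have h2 := entry_ge T (μ.colLen 0) _ _ (by simp [mem_col]) hm
  omega

theorem row_part_zero (P : ℕ → Prop) [DecidablePred P] (h : ∀ j, (0, j) ∈ π.cells \ μ.cells → ¬ P j) :
    ((Finset.range (π.rowLen 0)).filter fun j => μ.rowLen 0 ≤ j ∧ P j).card = 0 := by
  rw [Finset.card_eq_zero, Finset.filter_eq_empty_iff]
  rintro j hj ⟨h1, h2⟩
  refine h j ?_ h2
  rw [mem_skew, mem_row, mem_row]
  simp at hj
  omega

theorem strip_le (h : μ ≤ π) : stripRow μ ≤ stripRow π := by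
  rw [yd_le] at h ⊢
  intro i j
  rw [mem_stripRow, mem_stripRow]
  exact h _ _

theorem stripc_le (h : μ ≤ π) : stripCol μ ≤ stripCol π := by
  rw [yd_le] at h ⊢
  intro i j
  rw [mem_stripCol, mem_stripCol]
  exact h _ _

theorem strip_filling_row (T : LRFilling π μ ν) (h : π.rowLen 0 = μ.rowLen 0 + ν.rowLen 0) :
    Nonempty (LRFilling (stripRow π) (stripRow μ) (stripRow ν)) := by
  have hpos : ∀ i j, (i + 1, j) ∈ π.cells \ μ.cells → 0 < T.entry (i + 1) j := by
    intro i j hij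
    have h0 := zero_count T
    have h1 : (((stripRow π).cells \ (stripRow μ).cells).filter
      fun c => T.entry (c.1 + 1) c.2 = 0).card = 0 := by omega
    rw [Finset.card_eq_zero, Finset.filter_eq_empty_iff] at h1
    exact Nat.pos_of_ne_zero (h1 ((skew_row π μ i j).2 hij))
  refine ⟨⟨strip_le T.le, fun i j => T.entry (i + 1) j - 1, ?_, ?_, ?_, ?_, ?_⟩⟩
  · intro i j hij
    rw [skew_row] at hij
    simp [T.zeros _ _ hij]
  · intro i j h1 h2
    rw [skew_row] at h1 h2
    have := T.row_weak _ _ h1 h2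
    omega
  · intro i j h1 h2
    rw [skew_row] at h1 h2
    have := T.col_strict _ _ h1 h2
    have := hpos _ _ h1
    omega
  · intro k
    rw [rowLen_stripRow, ← T.content (k + 1), split_row π μ, row_part_zero, zero_add]
    · congr 1
      apply Finset.filter_congr
      rintro ⟨i, j⟩ hij
      rw [skew_row] at hij
      have := hpos _ _ hij
      simp only
      omega
    · intro j hj
      simp [row_zero T j hj]
  · intro i j k
    have h1 := T.lattice (i + 1) j (k + 1)
    rw [split_row π μ, split_row π μ, row_part_zero, row_part_zero, zero_add, zero_add] at h1
    · convert h1 using 2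
      · apply Finset.filter_congr
        rintro ⟨i, j⟩ hij
        rw [skew_row] at hij
        have := hpos _ _ hij
        simp only
        omega
      · apply Finset.filter_congr
        rintro ⟨i, j⟩ hij
        rw [skew_row] at hij
        have := hpos _ _ hij
        simp only
        omega
    · intro j hj
      simp [row_zero T j hj]
    · intro j hj
      simp [row_zero T j hj]

end filling

theorem extend_filling_row {π μ ν : YoungDiagram} (h : π.rowLen 0 = μ.rowLen 0 + ν.rowLen 0)
    (T : LRFilling (stripRow π) (stripRow μ) (stripRow ν)) : Nonempty (LRFilling π μ ν) := by
  have hs : ∀ (i j k : ℕ), (i, j) ∈ (stripRow π).cells \ (stripRow μ).cells →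
      ((if (i, j) ∈ (stripRow π).cells \ (stripRow μ).cells then T.entry i j + 1 else 0) = k + 1 ↔
        T.entry i j = k) := by
    intro i j k hij
    rw [if_pos hij]
    omega
  let e : ℕ → ℕ → ℕ := fun i j => match i with
    | 0 => 0
    | i + 1 => if (i, j) ∈ (stripRow π).cells \ (stripRow μ).cells then T.entry i j + 1 else 0
  have e0 : ∀ j, e 0 j = 0 := fun j => rfl
  have e1 : ∀ i j, (i, j) ∈ (stripRow π).cells \ (stripRow μ).cells →
      e (i + 1) j = T.entry i j + 1 := fun i j hij => if_pos hij
  have e2 : ∀ i j, (i, j) ∉ (stripRow π).cells \ (stripRow μ).cells →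
      e (i + 1) j = 0 := fun i j hij => if_neg hij
  clear_value e
  refine ⟨⟨?_, e, ?_, ?_, ?_, ?_, ?_⟩⟩
  · have h1 := T.le
    rw [yd_le] at h1 ⊢
    intro i j
    rcases i with _ | i
    · rw [mem_row, mem_row]
      omega
    · rw [← mem_stripRow, ← mem_stripRow]
      exact h1 i j
  · intro i j hij
    rcases i with _ | i
    · exact e0 j
    · rw [← skew_row] at hij
      exact e2 _ _ hij
  · intro i j h1 h2
    rcases i with _ | i
    · simp [e0]
    · rw [← skew_row] at h1 h2
      rw [e1 _ _ h1, e1 _ _ h2]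
      have := T.row_weak _ _ h1 h2
      omega
  · intro i j h1 h2
    rw [← skew_row] at h2
    rw [e1 _ _ h2]
    rcases i with _ | i
    · simp [e0]
    · rw [← skew_row] at h1
      rw [e1 _ _ h1]
      have := T.col_strict _ _ h1 h2
      omega
  · intro k
    rw [split_row π μ]
    rcases k with _ | k
    · have : (((stripRow π).cells \ (stripRow μ).cells).filter
          fun c => e (c.1 + 1) c.2 = 0).card = 0 := by
        rw [Finset.card_eq_zero, Finset.filter_eq_empty_iff]
        rintro ⟨i, j⟩ hij
        simp [e1 _ _ hij]
      simp only [this, e0]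
      have := row_part (π := π) (μ := μ)
      simp only [and_true] at this ⊢
      rw [this]
      omega
    · rw [row_part_zero, zero_add, ← rowLen_stripRow, ← T.content k]
      · congr 1
        apply Finset.filter_congr
        rintro ⟨i, j⟩ hij
        simp [e1 _ _ hij]
      · intro j hj
        simp [e0]
  · intro i j k
    rw [split_row π μ, split_row π μ, row_part_zero, zero_add]
    swap
    · intro j hj
      simp [e0]
    rcases i with _ | i
    · simp
    have key : ∀ k, (((stripRow π).cells \ (stripRow μ).cells).filter fun c : ℕ × ℕ =>
        (c.1 + 1 < i + 1 ∨ (c.1 + 1 = i + 1 ∧ j ≤ c.2)) ∧ e (c.1 + 1) c.2 = k + 1) =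
        (((stripRow π).cells \ (stripRow μ).cells).filter fun c : ℕ × ℕ =>
        (c.1 < i ∨ (c.1 = i ∧ j ≤ c.2)) ∧ T.entry c.1 c.2 = k) := by
      intro k
      apply Finset.filter_congr
      rintro ⟨i', j'⟩ hij
      simp [e1 _ _ hij]
    simp only [key]
    rcases k with _ | k
    · refine le_trans ?_ (Nat.le_add_right _ _)
      calc _ ≤ (((stripRow π).cells \ (stripRow μ).cells).filter fun c : ℕ × ℕ =>
              T.entry c.1 c.2 = 0).card := by
            apply Finset.card_le_card
            apply Finset.monotone_filter_right
            intro x hx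
            exact fun h => h.2
        _ = ν.rowLen 1 := by rw [T.content, rowLen_stripRow]
        _ ≤ ν.rowLen 0 := ν.rowLen_anti 0 1 (by omega)
        _ = π.rowLen 0 - μ.rowLen 0 := by omega
        _ = _ := by
          rw [← row_part]
          simp [e0]
    · refine le_trans ?_ (Nat.le_add_left _ _)
      simp only [key]
      exact T.lattice i j k

theorem col_part_one (n m k : ℕ) (P : ℕ → Prop) [DecidablePred P]
    (hP : ∀ i, i < n → m ≤ i → P i → i = m + k) :
    ((Finset.range n).filter fun i => m ≤ i ∧ P i).card =
      if m + k < n ∧ P (m + k) then 1 else 0 := by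
  split_ifs with h
  · rw [Finset.card_eq_one]
    refine ⟨m + k, ?_⟩
    ext i
    simp only [Finset.mem_filter, Finset.mem_range, Finset.mem_singleton]
    constructor
    · rintro ⟨h1, h2, h3⟩
      exact hP i h1 h2 h3
    · rintro rfl
      exact ⟨h.1, by omega, h.2⟩
  · rw [Finset.card_eq_zero, Finset.filter_eq_empty_iff]
    rintro i hi ⟨h1, h2⟩
    rw [Finset.mem_range] at hi
    obtain rfl := hP i hi h1 h2
    exact h ⟨hi, h2⟩

theorem rowLen_pos_iff (ν : YoungDiagram) (k : ℕ) : 0 < ν.rowLen k ↔ k < ν.colLen 0 := by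
  rw [← mem_row, mem_col]

theorem strip_filling_col {π μ ν : YoungDiagram} (T : LRFilling π μ ν)
    (h : π.colLen 0 = μ.colLen 0 + ν.colLen 0) :
    Nonempty (LRFilling (stripCol π) (stripCol μ) (stripCol ν)) := by
  have hcol : ∀ i, i < π.colLen 0 → μ.colLen 0 ≤ i → T.entry i 0 = i - μ.colLen 0 := by
    intro i h1 h2
    have hm : (i, 0) ∈ π.cells \ μ.cells := by
      simp only [mem_skew, mem_col]
      omega
    have hl : (i + (π.colLen 0 - 1 - i), 0) ∈ π.cells \ μ.cells := by
      simp only [mem_skew, mem_col]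
      omega
    have a1 := entry_lt T _ _ hl
    have a2 := entry_ge T (μ.colLen 0) _ _ (by simp [mem_col]) hm
    have a3 := col_mono T _ _ _ hm hl
    omega
  have hcontent : ∀ k, (((stripCol π).cells \ (stripCol μ).cells).filter
      fun c => T.entry c.1 (c.2 + 1) = k).card = (stripCol ν).rowLen k := by
    intro k
    have h1 := T.content k
    rw [split_col π μ, col_part_one _ _ k] at h1
    · rw [rowLen_stripCol]
      have h2 := rowLen_pos_iff ν k
      by_cases hk : k < ν.colLen 0
      · rw [if_pos] at h1
        · dsimp only at h1
          omega
        · have := hcol (μ.colLen 0 + k) (by omega) (by omega)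
          exact ⟨by omega, by simp only; omega⟩
      · rw [if_neg] at h1
        · dsimp only at h1
          omega
        · omega
    · intro i h1 h2 h3
      have := hcol i h1 h2
      simp only at h3
      omega
  refine ⟨⟨stripc_le T.le, fun i j => T.entry i (j + 1), ?_, ?_, ?_, hcontent, ?_⟩⟩
  · intro i j hij
    rw [skew_col] at hij
    exact T.zeros _ _ hij
  · intro i j h1 h2
    rw [skew_col] at h1 h2
    exact T.row_weak _ _ h1 h2
  · intro i j h1 h2
    rw [skew_col] at h1 h2
    exact T.col_strict _ _ h1 h2
  · intro i j k
    by_cases hi : μ.colLen 0 + k + 1 ≤ i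
    · calc _ ≤ (((stripCol π).cells \ (stripCol μ).cells).filter
              fun c => T.entry c.1 (c.2 + 1) = k + 1).card := by
            apply Finset.card_le_card
            apply Finset.monotone_filter_right
            intro x hx
            exact fun h => h.2
        _ = (stripCol ν).rowLen (k + 1) := hcontent _
        _ ≤ (stripCol ν).rowLen k := (stripCol ν).rowLen_anti _ _ (by omega)
        _ = (((stripCol π).cells \ (stripCol μ).cells).filter
              fun c => T.entry c.1 (c.2 + 1) = k).card := (hcontent _).symm
        _ ≤ _ := by
          apply Finset.card_le_card
          intro x hx
          obtain ⟨i', j'⟩ := x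
          rw [Finset.mem_filter] at hx ⊢
          refine ⟨hx.1, ?_, hx.2⟩
          have hx1 := hx.1
          rw [skew_col] at hx1
          have hnm : (μ.colLen 0, j' + 1) ∉ μ := by
            intro hh
            have := μ.up_left_mem (le_refl _) (Nat.zero_le _) hh
            rw [mem_col] at this
            omega
          have := entry_ge T (μ.colLen 0) _ _ hnm hx1
          have := hx.2
          simp only at this ⊢
          omega
    · have h1 := T.lattice i (j + 1) k
      rw [split_col π μ, split_col π μ, col_part_one _ _ (k + 1), col_part_one _ _ k, if_neg, if_neg,
        zero_add, zero_add] at h1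
      · simpa using h1
      · rintro ⟨_, h2, _⟩
        simp only at h2
        omega
      · rintro ⟨_, h2, _⟩
        simp only at h2
        omega
      · rintro i h1 h2 ⟨_, h3⟩
        have := hcol i h1 h2
        simp only at h3
        omega
      · rintro i h1 h2 ⟨_, h3⟩
        have := hcol i h1 h2
        simp only at h3
        omega

theorem extend_filling_col {π μ ν : YoungDiagram} (h : π.colLen 0 = μ.colLen 0 + ν.colLen 0)
    (T : LRFilling (stripCol π) (stripCol μ) (stripCol ν)) : Nonempty (LRFilling π μ ν) := by
  let e : ℕ → ℕ → ℕ := fun i j => match j with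
    | 0 => if i < π.colLen 0 then i - μ.colLen 0 else 0
    | j + 1 => T.entry i j
  have e0 : ∀ i, i < π.colLen 0 → e i 0 = i - μ.colLen 0 := fun i hi => if_pos hi
  have e0' : ∀ i, ¬ i < π.colLen 0 → e i 0 = 0 := fun i hi => if_neg hi
  have e1 : ∀ i j, e i (j + 1) = T.entry i j := fun i j => rfl
  clear_value e
  refine ⟨⟨?_, e, ?_, ?_, ?_, ?_, ?_⟩⟩
  · have h1 := T.le
    rw [yd_le] at h1 ⊢
    intro i j
    rcases j with _ | j
    · rw [mem_col, mem_col]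
      omega
    · rw [← mem_stripCol, ← mem_stripCol]
      exact h1 i j
  · intro i j hij
    rcases j with _ | j
    · by_cases hi : i < π.colLen 0
      · rw [e0 i hi]
        simp only [mem_skew, mem_col] at hij
        omega
      · exact e0' i hi
    · rw [← skew_col] at hij
      rw [e1]
      exact T.zeros _ _ hij
  · intro i j h1 h2
    rw [← skew_col] at h2
    rw [e1]
    rcases j with _ | j
    · rw [e0]
      · apply entry_ge T _ _ _ _ h2
        rw [mem_stripCol]
        intro hh
        have := μ.up_left_mem (le_refl _) (Nat.zero_le _) hh
        rw [mem_col] at this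
        omega
      · simp only [mem_skew, mem_col] at h1
        exact h1.1
    · rw [← skew_col] at h1
      rw [e1]
      exact T.row_weak _ _ h1 h2
  · intro i j h1 h2
    rcases j with _ | j
    · simp only [mem_skew, mem_col] at h1 h2
      rw [e0 _ h1.1, e0 _ h2.1]
      omega
    · rw [← skew_col] at h1 h2
      rw [e1, e1]
      exact T.col_strict _ _ h1 h2
  · intro k
    rw [split_col π μ, col_part_one _ _ k]
    · simp only [e1]
      rw [T.content, rowLen_stripCol]
      have h2 := rowLen_pos_iff ν k
      by_cases hk : k < ν.colLen 0
      · rw [if_pos]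
        · omega
        · refine ⟨by omega, ?_⟩
          rw [e0 _ (by omega)]
          omega
      · rw [if_neg]
        · omega
        · omega
    · intro i h1 h2 h3
      have := e0 i h1
      simp only at h3
      omega
  · intro i j k
    rw [split_col π μ, split_col π μ]
    apply Nat.add_le_add
    · rw [col_part_one _ _ (k + 1), col_part_one _ _ k]
      · split_ifs with h1 h2
        · exact le_refl _
        · exfalso
          apply h2
          obtain ⟨a1, a2, a3⟩ := h1
          refine ⟨by omega, ?_, ?_⟩
          · simp only at a2 ⊢
            omega
          · rw [e0 _ (by omega)]
            omega
        · omega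
        · omega
      · rintro i h1 h2 ⟨_, h3⟩
        have := e0 i h1
        simp only at h3
        omega
      · rintro i h1 h2 ⟨_, h3⟩
        have := e0 i h1
        simp only at h3
        omega
    · have h1 := T.lattice i (j - 1) k
      simpa only [e1, Nat.sub_le_iff_le_add] using h1

/-- The row case of the recursion. -/
theorem compl_stripRow (c d : ℕ) (μ : YoungDiagram) (h0 : μ.rowLen 0 = 2 * d) :
    stripRow (rectCompl (2 * (c + 1)) (2 * d) μ) = rectCompl (2 * c) (2 * d) (stripRow μ) := by
  apply yd_ext
  intro i j
  rw [mem_stripRow, mem_compl, mem_compl, mem_stripRow]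
  by_cases hi : i < 2 * c
  · have : 2 * (c + 1) - 1 - (i + 1) = 2 * c - 1 - i + 1 := by omega
    rw [this]
    have : i + 1 < 2 * (c + 1) ↔ i < 2 * c := by omega
    rw [this]
  · constructor
    · rintro ⟨⟨h1, h2⟩, h3⟩
      exfalso
      apply h3
      have : 2 * (c + 1) - 1 - (i + 1) = 0 := by omega
      rw [this, mem_row]
      omega
    · rintro ⟨⟨h1, h2⟩, h3⟩
      omega

theorem compl_stripCol (c d : ℕ) (μ : YoungDiagram) (h0 : μ.colLen 0 = 2 * c) :
    stripCol (rectCompl (2 * c) (2 * (d + 1)) μ) = rectCompl (2 * c) (2 * d) (stripCol μ) := by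
  apply yd_ext
  intro i j
  rw [mem_stripCol, mem_compl, mem_compl, mem_stripCol]
  by_cases hi : j < 2 * d
  · have : 2 * (d + 1) - 1 - (j + 1) = 2 * d - 1 - j + 1 := by omega
    rw [this]
    have : j + 1 < 2 * (d + 1) ↔ j < 2 * d := by omega
    rw [this]
  · constructor
    · rintro ⟨⟨h1, h2⟩, h3⟩
      exfalso
      apply h3
      have : 2 * (d + 1) - 1 - (j + 1) = 0 := by omega
      rw [this, mem_col]
      omega
    · rintro ⟨⟨h1, h2⟩, h3⟩
      omega

theorem rowLen_le {a b : ℕ} {μ : YoungDiagram} (h : μ ≤ rect a b) (i : ℕ) : μ.rowLen i ≤ b := by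
  by_contra hh
  have := h ((mem_row μ i b).2 (by omega))
  have := (mem_rect a b i b).1 this
  omega

theorem colLen_le {a b : ℕ} {μ : YoungDiagram} (h : μ ≤ rect a b) (i : ℕ) : μ.colLen i ≤ a := by
  by_contra hh
  have := h ((mem_col μ a i).2 (by omega))
  have := (mem_rect a b a i).1 this
  omega

theorem compl_le (a b : ℕ) (μ : YoungDiagram) : rectCompl a b μ ≤ rect a b := by
  rw [yd_le]
  intro i j
  rw [mem_compl, mem_rect]
  exact fun h => h.1

theorem compl_row0 (c d : ℕ) (μ : YoungDiagram) (h0 : stripRow μ ≤ rect (2 * c) (2 * d)) :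
    (rectCompl (2 * (c + 1)) (2 * d) μ).rowLen 0 = 2 * d := by
  apply eq_of_lt
  intro j
  rw [← mem_row, mem_compl]
  constructor
  · rintro ⟨⟨h1, h2⟩, h3⟩
    exact h2
  · intro h
    refine ⟨⟨by omega, h⟩, fun hh => ?_⟩
    have : 2 * (c + 1) - 1 - 0 = 2 * c + 1 := by omega
    rw [this, ← mem_stripRow] at hh
    have := (mem_rect _ _ _ _).1 (h0 hh)
    omega

theorem strip_le_rect (c d : ℕ) (μ : YoungDiagram) (h : μ ≤ rect (2 * (c + 1)) (2 * d))
    (h0 : (rectCompl (2 * (c + 1)) (2 * d) μ).rowLen 0 = 2 * d) :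
    stripRow μ ≤ rect (2 * c) (2 * d) := by
  rw [yd_le]
  intro i j hij
  rw [mem_stripRow] at hij
  have h1 := (mem_rect _ _ _ _).1 (h hij)
  rw [mem_rect]
  refine ⟨?_, h1.2⟩
  by_contra hi
  have : i = 2 * c := by omega
  subst this
  have h2 : (0, 2 * d - 1) ∈ rectCompl (2 * (c + 1)) (2 * d) μ := by
    rw [mem_row]
    omega
  rw [mem_compl] at h2
  apply h2.2
  exact μ.up_left_mem (by omega) (by omega) hij

theorem compl_col0 (c d : ℕ) (μ : YoungDiagram) (h0 : stripCol μ ≤ rect (2 * c) (2 * d)) :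
    (rectCompl (2 * c) (2 * (d + 1)) μ).colLen 0 = 2 * c := by
  apply eq_of_lt
  intro j
  rw [← mem_col, mem_compl]
  constructor
  · rintro ⟨⟨h1, h2⟩, h3⟩
    exact h1
  · intro h
    refine ⟨⟨h, by omega⟩, fun hh => ?_⟩
    have : 2 * (d + 1) - 1 - 0 = 2 * d + 1 := by omega
    rw [this, ← mem_stripCol] at hh
    have := (mem_rect _ _ _ _).1 (h0 hh)
    omega

theorem stripc_le_rect (c d : ℕ) (μ : YoungDiagram) (h : μ ≤ rect (2 * c) (2 * (d + 1)))
    (h0 : (rectCompl (2 * c) (2 * (d + 1)) μ).colLen 0 = 2 * c) :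
    stripCol μ ≤ rect (2 * c) (2 * d) := by
  rw [yd_le]
  intro i j hij
  rw [mem_stripCol] at hij
  have h1 := (mem_rect _ _ _ _).1 (h hij)
  rw [mem_rect]
  refine ⟨h1.1, ?_⟩
  by_contra hi
  have : j = 2 * d := by omega
  subst this
  have h2 : (2 * c - 1, 0) ∈ rectCompl (2 * c) (2 * (d + 1)) μ := by
    rw [mem_col]
    omega
  rw [mem_compl] at h2
  apply h2.2
  exact μ.up_left_mem (by omega) (by omega) hij

/-- `IsScaled q w μ`: each `w`-piece of `μ` has `q` times (remaining count) boxes. -/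
def IsScaled (q : ℕ) : List Bool → YoungDiagram → Prop
  | [], μ => μ = ⊥
  | true :: w, μ => μ.rowLen 0 = q * w.count false ∧ IsScaled q w (stripRow μ)
  | false :: w, μ => μ.colLen 0 = q * w.count true ∧ IsScaled q w (stripCol μ)

abbrev wr (w : List Bool) : YoungDiagram := rect (2 * w.count true) (2 * w.count false)

abbrev wc (w : List Bool) (μ : YoungDiagram) : YoungDiagram :=
  rectCompl (2 * w.count true) (2 * w.count false) μ

theorem row_ext {μ ν : YoungDiagram} (h0 : μ.rowLen 0 = ν.rowLen 0)
    (h : stripRow μ = stripRow ν) : μ = ν := by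
  apply yd_ext
  intro i j
  rcases i with _ | i
  · rw [mem_row, mem_row, h0]
  · rw [← mem_stripRow, ← mem_stripRow, h]

theorem col_ext {μ ν : YoungDiagram} (h0 : μ.colLen 0 = ν.colLen 0)
    (h : stripCol μ = stripCol ν) : μ = ν := by
  apply yd_ext
  intro i j
  rcases j with _ | j
  · rw [mem_col, mem_col, h0]
  · rw [← mem_stripCol, ← mem_stripCol, h]

theorem scaled_unique (q : ℕ) (w : List Bool) : ∀ μ ν, IsScaled q w μ → IsScaled q w ν → μ = ν := by
  induction w with
  | nil => intro μ ν h1 h2; exact h1.trans h2.symm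
  | cons x w ih =>
    intro μ ν h1 h2
    cases x
    · exact col_ext (h1.1.trans h2.1.symm) (ih _ _ h1.2 h2.2)
    · exact row_ext (h1.1.trans h2.1.symm) (ih _ _ h1.2 h2.2)

theorem eq_bot_of {μ : YoungDiagram} (h : ∀ i j, (i, j) ∉ μ) : μ = ⊥ := by
  apply yd_ext
  intro i j
  simp [h i j]

theorem scaled_self (w : List Bool) : ∀ μ, IsScaled 2 w μ → μ ≤ wr w ∧ wc w μ = μ := by
  induction w with
  | nil =>
    rintro μ rfl
    refine ⟨bot_le, eq_bot_of ?_⟩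
    intro i j h
    have := (mem_compl _ _ _ _ _).1 h
    simp at this
  | cons x w ih =>
    intro μ h
    cases x
    · obtain ⟨h1, h2⟩ := h
      obtain ⟨h3, h4⟩ := ih _ h2
      have e1 : (false :: w).count true = w.count true := by simp
      have e2 : (false :: w).count false = w.count false + 1 := by simp
      simp only [wr, wc, e1, e2] at h3 h4 ⊢
      refine ⟨?_, ?_⟩
      · rw [yd_le]
        intro i j hij
        rw [mem_rect]
        rcases j with _ | j
        · rw [mem_col] at hij
          omega
        · have := (mem_rect _ _ _ _).1 (h3 ((mem_stripCol _ _ _).2 hij))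
          omega
      · apply col_ext
        · rw [compl_col0 _ _ _ h3, h1]
        · rw [compl_stripCol _ _ _ h1, h4]
    · obtain ⟨h1, h2⟩ := h
      obtain ⟨h3, h4⟩ := ih _ h2
      have e1 : (true :: w).count true = w.count true + 1 := by simp
      have e2 : (true :: w).count false = w.count false := by simp
      simp only [wr, wc, e1, e2] at h3 h4 ⊢
      refine ⟨?_, ?_⟩
      · rw [yd_le]
        intro i j hij
        rw [mem_rect]
        rcases i with _ | i
        · rw [mem_row] at hij
          omega
        · have := (mem_rect _ _ _ _).1 (h3 ((mem_stripRow _ _ _).2 hij))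
          omega
      · apply row_ext
        · rw [compl_row0 _ _ _ h3, h1]
        · rw [compl_stripRow _ _ _ h1, h4]

theorem exists_addRow {a b : ℕ} (μ : YoungDiagram) (h : μ ≤ rect a b) :
    ∃ μ', μ'.rowLen 0 = b ∧ stripRow μ' = μ := by
  have hl : IsLowerSet (((rect (a + 1) b).cells.filter fun x => x.1 = 0 ∨ (x.1 - 1, x.2) ∈ μ :
      Finset (ℕ × ℕ)) : Set (ℕ × ℕ)) := by
    rintro ⟨i, j⟩ ⟨i', j'⟩ ⟨hi, hj⟩ hm
    simp only [Finset.coe_filter, Set.mem_setOf_eq] at hm ⊢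
    refine ⟨(rect _ _).isLowerSet ⟨hi, hj⟩ hm.1, ?_⟩
    simp only at hi hj
    rcases hm.2 with h0 | h0
    · left
      omega
    · right
      exact μ.up_left_mem (by omega) hj h0
  have hmem : ∀ i j, (i, j) ∈ (⟨_, hl⟩ : YoungDiagram) ↔
      (i < a + 1 ∧ j < b) ∧ (i = 0 ∨ (i - 1, j) ∈ μ) := by
    intro i j
    rw [← mem_rect, ← YoungDiagram.mem_cells]
    simp
  refine ⟨⟨_, hl⟩, ?_, ?_⟩
  · apply eq_of_lt
    intro j
    rw [← mem_row, hmem]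
    simp
  · apply yd_ext
    intro i j
    rw [mem_stripRow, hmem]
    constructor
    · rintro ⟨_, h1⟩
      simpa using h1
    · intro h1
      have := (mem_rect _ _ _ _).1 (h h1)
      exact ⟨by omega, Or.inr (by simpa using h1)⟩

theorem exists_addCol {a b : ℕ} (μ : YoungDiagram) (h : μ ≤ rect a b) :
    ∃ μ', μ'.colLen 0 = a ∧ stripCol μ' = μ := by
  obtain ⟨ν, h1, h2⟩ := exists_addRow (a := b) (b := a) μ.transpose (by
    rw [yd_le]
    intro i j hij
    rw [YoungDiagram.mem_transpose] at hij
    have := (mem_rect _ _ _ _).1 (h hij)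
    rw [mem_rect]
    exact ⟨this.2, this.1⟩)
  refine ⟨ν.transpose, by simpa using h1, ?_⟩
  simp [stripCol, h2]

theorem scaled_exists (w : List Bool) : ∃ μ, IsScaled 2 w μ := by
  induction w with
  | nil => exact ⟨⊥, rfl⟩
  | cons x w ih =>
    obtain ⟨μ, hμ⟩ := ih
    have h := (scaled_self w μ hμ).1
    cases x
    · obtain ⟨ν, h1, h2⟩ := exists_addCol μ h
      exact ⟨ν, h1, h2 ▸ hμ⟩
    · obtain ⟨ν, h1, h2⟩ := exists_addRow μ h
      exact ⟨ν, h1, h2 ▸ hμ⟩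

theorem pieces_row (w : List Bool) (μ : YoungDiagram) : ∀ r c,
    wPieces w (r + 1) c μ = wPieces w r c (stripRow μ) := by
  induction w with
  | nil => intros; rfl
  | cons x w ih =>
    intro r c
    cases x
    · simp only [wPieces, ih, colLen_stripRow]
      congr 1
      omega
    · simp only [wPieces, ih, rowLen_stripRow]

theorem pieces_col (w : List Bool) (μ : YoungDiagram) : ∀ r c,
    wPieces w r (c + 1) μ = wPieces w r c (stripCol μ) := by
  induction w with
  | nil => intros; rfl
  | cons x w ih =>
    intro r c
    cases x
    · simp only [wPieces, ih, colLen_stripCol]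
    · simp only [wPieces, ih, rowLen_stripCol]
      congr 1
      omega

theorem not_row (w : List Bool) (μ : YoungDiagram) :
    wNotation (true :: w) μ = μ.rowLen 0 :: wNotation w (stripRow μ) := by
  simp [wNotation, wPieces, ← pieces_row]

theorem not_col (w : List Bool) (μ : YoungDiagram) :
    wNotation (false :: w) μ = μ.colLen 0 :: wNotation w (stripCol μ) := by
  simp [wNotation, wPieces, ← pieces_col]

theorem lexLE_cons {a b : ℕ} {l m : List ℕ} (h : lexLE (a :: l) (b :: m)) (hb : b ≤ a) :
    a = b ∧ lexLE l m := by
  rcases h with h | h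
  · simp only [List.cons.injEq] at h
    exact ⟨h.1, Or.inl h.2⟩
  · cases h with
    | cons h => exact ⟨rfl, Or.inr h⟩
    | rel h => omega

theorem scaled_of_max (w : List Bool) : ∀ L lam, IsScaled 2 w L → lam ≤ wr w → wc w lam = lam →
    lexLE (wNotation w L) (wNotation w lam) → IsScaled 2 w lam := by
  induction w with
  | nil =>
    intro L lam _ h _ _
    apply eq_bot_of
    intro i j hij
    have := (mem_rect _ _ _ _).1 (h hij)
    simp at this
  | cons x w ih =>
    intro L lam hL h hs hlex
    cases x
    · rw [not_col, not_col] at hlex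
      have e1 : (false :: w).count true = w.count true := by simp
      have e2 : (false :: w).count false = w.count false + 1 := by simp
      simp only [wr, wc, e1, e2] at h hs
      obtain ⟨h1, h2⟩ := lexLE_cons hlex (by rw [hL.1]; exact colLen_le h 0)
      have h0 : lam.colLen 0 = 2 * w.count true := h1.symm.trans hL.1
      refine ⟨h0, ih _ _ hL.2 (stripc_le_rect _ _ _ h (by rw [hs, h0])) ?_ h2⟩
      rw [wc, ← compl_stripCol _ _ _ h0, hs]
    · rw [not_row, not_row] at hlex
      have e1 : (true :: w).count true = w.count true + 1 := by simp
      have e2 : (true :: w).count false = w.count false := by simp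
      simp only [wr, wc, e1, e2] at h hs
      obtain ⟨h1, h2⟩ := lexLE_cons hlex (by rw [hL.1]; exact rowLen_le h 0)
      have h0 : lam.rowLen 0 = 2 * w.count false := h1.symm.trans hL.1
      refine ⟨h0, ih _ _ hL.2 (strip_le_rect _ _ _ h (by rw [hs, h0])) ?_ h2⟩
      rw [wc, ← compl_stripRow _ _ _ h0, hs]

theorem scaled_pi (w : List Bool) : ∀ L π, w ≠ [] → IsScaled 2 w L →
    wNotation w π = (wNotation w L).map (fun x => 2 * x) → IsScaled 4 w π := by
  induction w with
  | nil => intro L π h; exact absurd rfl h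
  | cons x w ih =>
    intro L π _ hL h
    cases x
    · rw [not_col, not_col, List.map_cons, List.cons.injEq] at h
      have h0 : π.colLen 0 = 4 * w.count true := by rw [h.1, hL.1]; ring
      refine ⟨h0, ?_⟩
      by_cases hw : w = []
      · subst hw
        apply eq_bot_of
        intro i j hij
        rw [mem_stripCol] at hij
        have := π.up_left_mem (le_refl _) (Nat.zero_le _) hij
        rw [mem_col] at this
        simp at h0
        omega
      · exact ih _ _ hw hL.2 h.2
    · rw [not_row, not_row, List.map_cons, List.cons.injEq] at h
      have h0 : π.rowLen 0 = 4 * w.count false := by rw [h.1, hL.1]; ring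
      refine ⟨h0, ?_⟩
      by_cases hw : w = []
      · subst hw
        apply eq_bot_of
        intro i j hij
        rw [mem_stripRow] at hij
        have := π.up_left_mem (Nat.zero_le _) (le_refl _) hij
        rw [mem_row] at this
        simp at h0
        omega
      · exact ih _ _ hw hL.2 h.2

theorem nonempty_bot : Nonempty (LRFilling ⊥ ⊥ ⊥) := by
  refine ⟨⟨le_refl _, fun _ _ => 0, ?_, ?_, ?_, ?_, ?_⟩⟩
  · simp
  · simp
  · simp
  · intro k
    have : (⊥ : YoungDiagram).rowLen k = 0 := by
      apply eq_of_lt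
      intro j
      rw [← mem_row]
      simp
    simp [this]
  · simp

theorem main (w : List Bool) : ∀ π μ, IsScaled 4 w π → μ ≤ wr w →
    (Nonempty (LRFilling π μ (wc w μ)) ↔ IsScaled 2 w μ) := by
  induction w with
  | nil =>
    intro π μ hπ hμ
    have hμ' : μ = ⊥ := by
      apply eq_bot_of
      intro i j hij
      have := (mem_rect _ _ _ _).1 (hμ hij)
      simp at this
    have hπ' : π = ⊥ := hπ
    subst hμ'
    subst hπ'
    rw [(scaled_self [] ⊥ rfl).2]
    exact ⟨fun _ => rfl, fun _ => nonempty_bot⟩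
  | cons x w ih =>
    intro π μ hπ hμ
    cases x
    · have e1 : (false :: w).count true = w.count true := by simp
      have e2 : (false :: w).count false = w.count false + 1 := by simp
      obtain ⟨p1, p2⟩ := hπ
      constructor
      · rintro ⟨T⟩
        simp only [wr, wc, e1, e2] at hμ T
        have h1 := col_le T
        have h2 := colLen_le hμ 0
        have h3 := colLen_le (compl_le (2 * w.count true) (2 * (w.count false + 1)) μ) 0
        have h4 : μ.colLen 0 = 2 * w.count true := by omega
        obtain ⟨T'⟩ := strip_filling_col T (by omega)
        rw [compl_stripCol _ _ _ h4] at T'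
        refine ⟨h4, (ih _ _ p2 ?_).1 ⟨T'⟩⟩
        exact stripc_le_rect _ _ _ hμ (by omega)
      · rintro ⟨h4, h5⟩
        simp only [wr, wc, e1, e2] at hμ ⊢
        have h6 := (scaled_self w _ h5).1
        obtain ⟨T⟩ := (ih _ _ p2 h6).2 h5
        rw [wc, ← compl_stripCol _ _ _ h4] at T
        refine extend_filling_col ?_ T
        rw [compl_col0 _ _ _ h6]
        omega
    · have e1 : (true :: w).count true = w.count true + 1 := by simp
      have e2 : (true :: w).count false = w.count false := by simp
      obtain ⟨p1, p2⟩ := hπ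
      constructor
      · rintro ⟨T⟩
        simp only [wr, wc, e1, e2] at hμ T
        have h1 := row_le T
        have h2 := rowLen_le hμ 0
        have h3 := rowLen_le (compl_le (2 * (w.count true + 1)) (2 * w.count false) μ) 0
        have h4 : μ.rowLen 0 = 2 * w.count false := by omega
        obtain ⟨T'⟩ := strip_filling_row T (by omega)
        rw [compl_stripRow _ _ _ h4] at T'
        refine ⟨h4, (ih _ _ p2 ?_).1 ⟨T'⟩⟩
        exact strip_le_rect _ _ _ hμ (by omega)
      · rintro ⟨h4, h5⟩
        simp only [wr, wc, e1, e2] at hμ ⊢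
        have h6 := (scaled_self w _ h5).1
        obtain ⟨T⟩ := (ih _ _ p2 h6).2 h5
        rw [wc, ← compl_stripRow _ _ _ h4] at T
        refine extend_filling_row ?_ T
        rw [compl_row0 _ _ _ h6]
        omega

end LRAux

/-- Let `a = 2c`, `b = 2d` be even positive, `R = (b^a)`, and `w` a word
with `c` `h`'s and `d` `v`'s.  Let `lam` be the `w`-maximal self-complementary partition in
`R` and `π` the partition with `π^w = 2 ⬝ lam^w`.  Then for every `μ ⊆ R`, the
Littlewood–Richardson coefficient `c^π_{μ,μᶜ}` is nonzero iff `μ = lam`. -/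
theorem statement4 (c d : ℕ) (hc : 0 < c) (hd : 0 < d) (w : List Bool)
    (hlen : w.length = c + d) (hcnt : w.count true = c) (hcnt' : w.count false = d)
    (lam : YoungDiagram) (hlam : lam ≤ rect (2 * c) (2 * d))
    (hsc : rectCompl (2 * c) (2 * d) lam = lam)
    (hmax : ∀ μ : YoungDiagram, μ ≤ rect (2 * c) (2 * d) →
      rectCompl (2 * c) (2 * d) μ = μ → lexLE (wNotation w μ) (wNotation w lam))
    (π : YoungDiagram) (hπ : wNotation w π = (wNotation w lam).map fun x => 2 * x) :
    ∀ μ : YoungDiagram, μ ≤ rect (2 * c) (2 * d) →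
      (lrCoeff π μ (rectCompl (2 * c) (2 * d) μ) ≠ 0 ↔ μ = lam) := by
  subst hcnt hcnt'
  obtain ⟨L, hL⟩ := LRAux.scaled_exists w
  have hLs := LRAux.scaled_self w L hL
  have hl : LRAux.IsScaled 2 w lam :=
    LRAux.scaled_of_max w L lam hL hlam hsc (hmax L hLs.1 hLs.2)
  have hw : w ≠ [] := by
    rintro rfl
    simp at hc
  have hp := LRAux.scaled_pi w lam π hw hl hπ
  intro μ hμ
  have hm := LRAux.main w π μ hp hμ
  rw [lrCoeff, ← Nat.pos_iff_ne_zero, Nat.card_pos_iff]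
  constructor
  · rintro ⟨h, _⟩
    exact LRAux.scaled_unique 2 w _ _ (hm.1 h) hl
  · rintro rfl
    exact ⟨hm.2 hl, LRAux.finite_LR⟩
end

section
/- Let a, b be positive integers, R = (b^a), and let λ ⊆ R be a self-complementary partition (λ = λ^c). Then there exists a partition π (a witness) such that for every partition μ ⊆ R, the Littlewood–Richardson coefficient c^π_{μ, μ^c} is nonzero if and only if μ = λ. -/
open scoped Classical

lemma mem_stripRow (lam : YoungDiagram) (i j : ℕ) : (i, j) ∈ stripRow lam ↔ (i + 1, j) ∈ lam := by
  rw [← YoungDiagram.mem_cells, ← YoungDiagram.mem_cells]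
  simp only [stripRow, Finset.mem_image, Finset.mem_filter, Prod.exists, Prod.mk.injEq]
  constructor
  · rintro ⟨x, y, ⟨h, hx⟩, h1, h2⟩
    obtain rfl : x = i + 1 := by omega
    subst h2; exact h
  · intro h
    exact ⟨i + 1, j, ⟨h, by omega⟩, by omega, rfl⟩

lemma mem_stripCol (lam : YoungDiagram) (i j : ℕ) : (i, j) ∈ stripCol lam ↔ (i, j + 1) ∈ lam := by
  rw [stripCol, YoungDiagram.mem_transpose, Prod.swap_prod_mk, mem_stripRow,
    YoungDiagram.mem_transpose, Prod.swap_prod_mk]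

lemma mem_rect (a b i j : ℕ) : (i, j) ∈ rect a b ↔ i < a ∧ j < b := by
  rw [← YoungDiagram.mem_cells]
  simp [rect]

lemma mem_rectCompl (a b i j : ℕ) (μ : YoungDiagram) :
    (i, j) ∈ rectCompl a b μ ↔ (i < a ∧ j < b) ∧ (a - 1 - i, b - 1 - j) ∉ μ := by
  rw [← YoungDiagram.mem_cells]
  simp only [rectCompl, Finset.mem_filter, YoungDiagram.mem_cells, mem_rect]

lemma yd_ext {μ ν : YoungDiagram} (h : ∀ i j, (i, j) ∈ μ ↔ (i, j) ∈ ν) : μ = ν := by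
  apply YoungDiagram.ext
  ext ⟨i, j⟩
  simpa using h i j

lemma yd_le {μ ν : YoungDiagram} : μ ≤ ν ↔ ∀ i j, (i, j) ∈ μ → (i, j) ∈ ν := by
  constructor
  · intro h i j hm
    exact h hm
  · rintro h ⟨i, j⟩ hm
    exact h i j hm

lemma mem_skew (π μ : YoungDiagram) (i j : ℕ) :
    (i, j) ∈ π.cells \ μ.cells ↔ (i, j) ∈ π ∧ (i, j) ∉ μ := by
  simp

lemma rowLen_stripRow (ν : YoungDiagram) (k : ℕ) : (stripRow ν).rowLen k = ν.rowLen (k + 1) := by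
  apply eq_of_forall_lt_iff
  intro c
  rw [← YoungDiagram.mem_iff_lt_rowLen, ← YoungDiagram.mem_iff_lt_rowLen, mem_stripRow]

lemma rowLen_stripCol (ν : YoungDiagram) (k : ℕ) : (stripCol ν).rowLen k = ν.rowLen k - 1 := by
  apply eq_of_forall_lt_iff
  intro c
  rw [← YoungDiagram.mem_iff_lt_rowLen, mem_stripCol, YoungDiagram.mem_iff_lt_rowLen]
  omega

lemma card_row (π μ : YoungDiagram) (P Q : ℕ × ℕ → Prop) [DecidablePred P] [DecidablePred Q]
    (hPQ : ∀ i j, (i + 1, j) ∈ π → (i + 1, j) ∉ μ → (P (i + 1, j) ↔ Q (i, j))) :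
    ((π.cells \ μ.cells).filter P).card =
      (((stripRow π).cells \ (stripRow μ).cells).filter Q).card +
      ((π.cells \ μ.cells).filter (fun c => c.1 = 0 ∧ P c)).card := by
  have h1 : (((stripRow π).cells \ (stripRow μ).cells).filter Q).card =
      ((π.cells \ μ.cells).filter (fun c => c.1 ≠ 0 ∧ P c)).card := by
    apply Finset.card_bij (fun c _ => (c.1 + 1, c.2))
    · rintro ⟨i, j⟩ h
      simp only [Finset.mem_filter, mem_skew, mem_stripRow] at h ⊢
      exact ⟨h.1, by simp, (hPQ i j h.1.1 h.1.2).2 h.2⟩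
    · rintro ⟨i, j⟩ _ ⟨i', j'⟩ _ h
      simpa using h
    · rintro ⟨i, j⟩ h
      simp only [Finset.mem_filter, mem_skew] at h
      obtain ⟨i, rfl⟩ := Nat.exists_eq_succ_of_ne_zero h.2.1
      refine ⟨(i, j), ?_, rfl⟩
      simp only [Finset.mem_filter, mem_skew, mem_stripRow]
      exact ⟨h.1, (hPQ i j h.1.1 h.1.2).1 h.2.2⟩
  rw [h1, ← Finset.card_filter_add_card_filter_not (s := (π.cells \ μ.cells).filter P)
    (fun c => c.1 = 0), Finset.filter_filter, Finset.filter_filter, add_comm]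
  congr 2 <;> (ext c; simp only [Finset.mem_filter]; tauto)

lemma card_col (π μ : YoungDiagram) (P Q : ℕ × ℕ → Prop) [DecidablePred P] [DecidablePred Q]
    (hPQ : ∀ i j, (i, j + 1) ∈ π → (i, j + 1) ∉ μ → (P (i, j + 1) ↔ Q (i, j))) :
    ((π.cells \ μ.cells).filter P).card =
      (((stripCol π).cells \ (stripCol μ).cells).filter Q).card +
      ((π.cells \ μ.cells).filter (fun c => c.2 = 0 ∧ P c)).card := by
  have h1 : (((stripCol π).cells \ (stripCol μ).cells).filter Q).card =
      ((π.cells \ μ.cells).filter (fun c => c.2 ≠ 0 ∧ P c)).card := by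
    apply Finset.card_bij (fun c _ => (c.1, c.2 + 1))
    · rintro ⟨i, j⟩ h
      simp only [Finset.mem_filter, mem_skew, mem_stripCol] at h ⊢
      exact ⟨h.1, by simp, (hPQ i j h.1.1 h.1.2).2 h.2⟩
    · rintro ⟨i, j⟩ _ ⟨i', j'⟩ _ h
      simpa using h
    · rintro ⟨i, j⟩ h
      simp only [Finset.mem_filter, mem_skew] at h
      obtain ⟨j, rfl⟩ := Nat.exists_eq_succ_of_ne_zero h.2.1
      refine ⟨(i, j), ?_, rfl⟩
      simp only [Finset.mem_filter, mem_skew, mem_stripCol]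
      exact ⟨h.1, (hPQ i j h.1.1 h.1.2).1 h.2.2⟩
  rw [h1, ← Finset.card_filter_add_card_filter_not (s := (π.cells \ μ.cells).filter P)
    (fun c => c.2 = 0), Finset.filter_filter, Finset.filter_filter, add_comm]
  congr 2 <;> (ext c; simp only [Finset.mem_filter]; tauto)

lemma card_row0 (π μ : YoungDiagram) :
    ((π.cells \ μ.cells).filter (fun c => c.1 = 0)).card = π.rowLen 0 - μ.rowLen 0 := by
  rw [← Nat.card_Ico]
  symm
  apply Finset.card_bij (fun j _ => (0, j))
  · intro j h
    simp only [Finset.mem_Ico] at h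
    simp only [Finset.mem_filter, mem_skew, YoungDiagram.mem_iff_lt_rowLen]
    exact ⟨⟨h.2, by omega⟩, trivial⟩
  · intro j _ j' _ h
    simpa using h
  · rintro ⟨i, j⟩ h
    simp only [Finset.mem_filter, mem_skew] at h
    obtain ⟨h, rfl⟩ := h
    simp only [YoungDiagram.mem_iff_lt_rowLen] at h
    exact ⟨j, by simp only [Finset.mem_Ico]; omega, rfl⟩

namespace LRFilling
variable {π μ ν : YoungDiagram}

lemma row_mono (T : LRFilling π μ ν) (i j d : ℕ) (h1 : (i, j) ∉ μ) (h2 : (i, j + d) ∈ π) :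
    T.entry i j ≤ T.entry i (j + d) := by
  induction d with
  | zero => simp
  | succ d ih =>
    have h3 : (i, j + d) ∈ π := π.up_left_mem le_rfl (by omega) h2
    refine (ih h3).trans (T.row_weak i (j + d) ?_ ?_)
    · exact (mem_skew _ _ _ _).2 ⟨h3, fun h => h1 (μ.up_left_mem le_rfl (by omega) h)⟩
    · exact (mem_skew _ _ _ _).2 ⟨h2, fun h => h1 (μ.up_left_mem le_rfl (by omega) h)⟩

lemma col_mono (T : LRFilling π μ ν) (i j d : ℕ) (h1 : (i, j) ∉ μ) (h2 : (i + d, j) ∈ π) :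
    T.entry i j + d ≤ T.entry (i + d) j := by
  induction d with
  | zero => simp
  | succ d ih =>
    have h3 : (i + d, j) ∈ π := π.up_left_mem (by omega) le_rfl h2
    have := T.col_strict (i + d) j
      ((mem_skew _ _ _ _).2 ⟨h3, fun h => h1 (μ.up_left_mem (by omega) le_rfl h)⟩)
      ((mem_skew _ _ _ _).2 ⟨h2, fun h => h1 (μ.up_left_mem (by omega) le_rfl h)⟩)
    have := ih h3
    change T.entry i j + (d + 1) ≤ T.entry (i + d + 1) j
    omega

lemma row0 (T : LRFilling π μ ν) (j : ℕ) (h2 : (0, j) ∈ π) (h1 : (0, j) ∉ μ) :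
    T.entry 0 j = 0 := by
  by_contra hne
  have hj := YoungDiagram.mem_iff_lt_rowLen.1 h2
  obtain ⟨d, hd⟩ : ∃ d, π.rowLen 0 = j + d + 1 := ⟨π.rowLen 0 - j - 1, by omega⟩
  have h3 : (0, j + d) ∈ π := YoungDiagram.mem_iff_lt_rowLen.2 (by omega)
  have h4 := T.row_mono 0 j d h1 h3
  obtain ⟨k, hk⟩ : ∃ k, T.entry 0 (j + d) = k + 1 := ⟨T.entry 0 (j + d) - 1, by omega⟩
  have h5 := T.lattice 0 (j + d) k
  have h6 : ((π.cells \ μ.cells).filter fun c =>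
        (c.1 < 0 ∨ (c.1 = 0 ∧ j + d ≤ c.2)) ∧ T.entry c.1 c.2 = k).card = 0 := by
    rw [Finset.card_eq_zero, Finset.filter_eq_empty_iff]
    rintro ⟨x, y⟩ hc ⟨h7, h8⟩
    simp only [mem_skew, YoungDiagram.mem_iff_lt_rowLen] at hc
    simp only at h7 h8
    obtain ⟨rfl, h9⟩ : x = 0 ∧ j + d ≤ y := by omega
    obtain rfl : y = j + d := by omega
    omega
  rw [h6, Nat.le_zero, Finset.card_eq_zero, Finset.filter_eq_empty_iff] at h5
  exact h5 ((mem_skew _ _ _ _).2 ⟨h3, fun h => h1 (μ.up_left_mem le_rfl (by omega) h)⟩)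
    ⟨Or.inr ⟨rfl, le_rfl⟩, hk⟩

lemma row0_subset (T : LRFilling π μ ν) :
    (π.cells \ μ.cells).filter (fun c => c.1 = 0) ⊆
    (π.cells \ μ.cells).filter (fun c => T.entry c.1 c.2 = 0) := by
  rintro ⟨i, j⟩ h
  simp only [Finset.mem_filter, mem_skew] at h ⊢
  obtain ⟨h, rfl⟩ := h
  exact ⟨h, T.row0 j h.1 h.2⟩

lemma rowLen_le (T : LRFilling π μ ν) : π.rowLen 0 ≤ μ.rowLen 0 + ν.rowLen 0 := by
  have h := Finset.card_le_card T.row0_subset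
  rw [card_row0, T.content 0] at h
  omega

lemma row_pos (T : LRFilling π μ ν) (h : μ.rowLen 0 + ν.rowLen 0 ≤ π.rowLen 0) (i j : ℕ)
    (h2 : (i + 1, j) ∈ π) (h1 : (i + 1, j) ∉ μ) : 0 < T.entry (i + 1) j := by
  by_contra hne
  have h3 := Finset.eq_of_subset_of_card_le T.row0_subset (by
    rw [card_row0, T.content 0]; omega)
  have h4 : (i + 1, j) ∈ (π.cells \ μ.cells).filter (fun c => T.entry c.1 c.2 = 0) := by
    simp only [Finset.mem_filter, mem_skew]
    exact ⟨⟨h2, h1⟩, by omega⟩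
  rw [← h3] at h4
  simp at h4

lemma stripRow_nonempty (T : LRFilling π μ ν) (h : μ.rowLen 0 + ν.rowLen 0 ≤ π.rowLen 0) :
    Nonempty (LRFilling (stripRow π) (stripRow μ) (stripRow ν)) := by
  have hz : ∀ k, ((π.cells \ μ.cells).filter (fun c => c.1 = 0 ∧ T.entry c.1 c.2 = k + 1)).card
      = 0 := by
    intro k
    rw [Finset.card_eq_zero, Finset.filter_eq_empty_iff]
    rintro ⟨x, y⟩ hc ⟨h7, h8⟩
    simp only [mem_skew] at hc h7 h8
    subst h7
    have := T.row0 y hc.1 hc.2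
    omega
  have hz2 : ∀ k i j, ((π.cells \ μ.cells).filter (fun c => c.1 = 0 ∧
      (c.1 < i + 1 ∨ (c.1 = i + 1 ∧ j ≤ c.2)) ∧ T.entry c.1 c.2 = k + 1)).card = 0 := by
    intro k i j
    refine Nat.le_zero.1 (le_of_le_of_eq ?_ (hz k))
    apply Finset.card_le_card
    apply Finset.monotone_filter_right
    rintro c _ ⟨h1, _, h2⟩
    exact ⟨h1, h2⟩
  refine ⟨⟨?_, fun i j => T.entry (i + 1) j - 1, ?_, ?_, ?_, ?_, ?_⟩⟩
  · rw [yd_le]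
    intro i j
    rw [mem_stripRow, mem_stripRow]
    exact yd_le.1 T.le _ _
  · intro i j hm
    rw [mem_skew, mem_stripRow, mem_stripRow, ← mem_skew] at hm
    simp [T.zeros _ _ hm]
  · intro i j h1 h2
    rw [mem_skew, mem_stripRow, mem_stripRow, ← mem_skew] at h1 h2
    have := T.row_weak _ _ h1 h2
    omega
  · intro i j h1 h2
    rw [mem_skew, mem_stripRow, mem_stripRow] at h1 h2
    have h3 := T.row_pos h _ _ h1.1 h1.2
    rw [← mem_skew] at h1 h2
    have := T.col_strict _ _ h1 h2
    omega
  · intro k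
    rw [rowLen_stripRow, ← T.content (k + 1), card_row π μ (fun c => T.entry c.1 c.2 = k + 1)
      (fun c => T.entry (c.1 + 1) c.2 - 1 = k), hz, add_zero]
    intro i j h1 h2
    have := T.row_pos h _ _ h1 h2
    simp only
    omega
  · intro i j k
    have := T.lattice (i + 1) j (k + 1)
    rw [card_row π μ (fun c => (c.1 < i + 1 ∨ (c.1 = i + 1 ∧ j ≤ c.2)) ∧
        T.entry c.1 c.2 = k + 1)
      (fun c => (c.1 < i ∨ (c.1 = i ∧ j ≤ c.2)) ∧ T.entry (c.1 + 1) c.2 - 1 = k), hz2, add_zero,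
      card_row π μ (fun c => (c.1 < i + 1 ∨ (c.1 = i + 1 ∧ j ≤ c.2)) ∧
        T.entry c.1 c.2 = k + 1 + 1)
      (fun c => (c.1 < i ∨ (c.1 = i ∧ j ≤ c.2)) ∧ T.entry (c.1 + 1) c.2 - 1 = k + 1), hz2,
      add_zero] at this
    · exact this
    all_goals
      intro i j h1 h2
      have := T.row_pos h _ _ h1 h2
      simp only
      omega

lemma of_stripRow (T : LRFilling (stripRow π) (stripRow μ) (stripRow ν))
    (h : μ.rowLen 0 + ν.rowLen 0 = π.rowLen 0) : Nonempty (LRFilling π μ ν) := by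
  set E : ℕ → ℕ → ℕ := fun i j =>
    if (i, j) ∈ π.cells \ μ.cells ∧ i ≠ 0 then T.entry (i - 1) j + 1 else 0 with hE
  have E0 : ∀ j, E 0 j = 0 := fun j => by simp [hE]
  have Es : ∀ i j, (i + 1, j) ∈ π → (i + 1, j) ∉ μ → E (i + 1) j = T.entry i j + 1 := by
    intro i j h1 h2
    simp [hE, h1, h2]
  have hz : ∀ k, ((π.cells \ μ.cells).filter (fun c => c.1 = 0 ∧ E c.1 c.2 = k + 1)).card
      = 0 := by
    intro k
    rw [Finset.card_eq_zero, Finset.filter_eq_empty_iff]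
    rintro ⟨x, y⟩ hc ⟨h7, h8⟩
    simp only at h7 h8
    subst h7
    have := E0 y
    omega
  have hz2 : ∀ k (Q : ℕ × ℕ → Prop), ((π.cells \ μ.cells).filter (fun c => c.1 = 0 ∧
      Q c ∧ E c.1 c.2 = k + 1)).card = 0 := by
    intro k Q
    refine Nat.le_zero.1 (le_of_le_of_eq ?_ (hz k))
    apply Finset.card_le_card
    apply Finset.monotone_filter_right
    rintro c _ ⟨h1, _, h2⟩
    exact ⟨h1, h2⟩
  have hcont : ∀ k, ((π.cells \ μ.cells).filter fun c => E c.1 c.2 = k).card = ν.rowLen k := by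
    intro k
    rcases k with _ | k
    · have h3 : ν.rowLen 0 = π.rowLen 0 - μ.rowLen 0 := by omega
      rw [h3, ← card_row0]
      congr 1
      ext ⟨i, j⟩
      simp only [Finset.mem_filter, mem_skew]
      refine and_congr_right fun hc => ?_
      rcases i with _ | i
      · simp [E0]
      · simp [Es i j hc.1 hc.2]
    · rw [← rowLen_stripRow, ← T.content k, card_row π μ (fun c => E c.1 c.2 = k + 1)
        (fun c => T.entry c.1 c.2 = k), hz, add_zero]
      intro i j h1 h2
      simp only [Es i j h1 h2]
      omega
  refine ⟨⟨?_, E, ?_, ?_, ?_, hcont, ?_⟩⟩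
  · rw [yd_le]
    intro i j
    rcases i with _ | i
    · rw [YoungDiagram.mem_iff_lt_rowLen, YoungDiagram.mem_iff_lt_rowLen]
      omega
    · rw [← mem_stripRow, ← mem_stripRow]
      exact yd_le.1 T.le _ _
  · intro i j hm
    simp only [hE]
    rw [if_neg]
    tauto
  · intro i j h1 h2
    rcases i with _ | i
    · simp [E0]
    · rw [mem_skew] at h1 h2
      rw [Es _ _ h1.1 h1.2, Es _ _ h2.1 h2.2]
      have := T.row_weak i j (by rwa [mem_skew, mem_stripRow, mem_stripRow])
        (by rwa [mem_skew, mem_stripRow, mem_stripRow])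
      omega
  · intro i j h1 h2
    rw [mem_skew] at h1 h2
    rcases i with _ | i
    · rw [E0, Es _ _ h2.1 h2.2]
      omega
    · rw [Es _ _ h1.1 h1.2, Es _ _ h2.1 h2.2]
      have := T.col_strict i j (by rwa [mem_skew, mem_stripRow, mem_stripRow])
        (by rwa [mem_skew, mem_stripRow, mem_stripRow])
      omega
  · intro i j k
    rcases i with _ | i
    · refine le_of_eq_of_le ?_ (Nat.zero_le _)
      rw [Finset.card_eq_zero, Finset.filter_eq_empty_iff]
      rintro ⟨x, y⟩ hc ⟨h7, h8⟩
      simp only at h7 h8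
      obtain rfl : x = 0 := by omega
      have := E0 y
      omega
    rcases k with _ | k
    · calc _ ≤ ((π.cells \ μ.cells).filter fun c => E c.1 c.2 = 0 + 1).card := by
            apply Finset.card_le_card
            apply Finset.monotone_filter_right
            rintro c _ ⟨_, h⟩
            exact h
        _ = ν.rowLen 1 := hcont _
        _ ≤ ν.rowLen 0 := ν.rowLen_anti _ _ (by omega)
        _ = ((π.cells \ μ.cells).filter fun c => E c.1 c.2 = 0).card := (hcont 0).symm
        _ ≤ _ := by
            apply Finset.card_le_card
            rintro ⟨x, y⟩ hc
            simp only [Finset.mem_filter, mem_skew] at hc ⊢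
            refine ⟨hc.1, ?_, hc.2⟩
            rcases x with _ | x
            · omega
            · rw [Es _ _ hc.1.1 hc.1.2] at hc
              omega
    · have := T.lattice i j k
      rw [card_row π μ (fun c => (c.1 < i + 1 ∨ (c.1 = i + 1 ∧ j ≤ c.2)) ∧
          E c.1 c.2 = k + 1)
        (fun c => (c.1 < i ∨ (c.1 = i ∧ j ≤ c.2)) ∧ T.entry c.1 c.2 = k),
        card_row π μ (fun c => (c.1 < i + 1 ∨ (c.1 = i + 1 ∧ j ≤ c.2)) ∧
          E c.1 c.2 = k + 1 + 1)
        (fun c => (c.1 < i ∨ (c.1 = i ∧ j ≤ c.2)) ∧ T.entry c.1 c.2 = k + 1)]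
      · have e1 := hz2 k (fun c => (c.1 < i + 1 ∨ (c.1 = i + 1 ∧ j ≤ c.2)))
        have e2 := hz2 (k + 1) (fun c => (c.1 < i + 1 ∨ (c.1 = i + 1 ∧ j ≤ c.2)))
        simp only [Finset.card_eq_zero, Finset.filter_eq_empty_iff] at e1 e2
        rw [Finset.filter_eq_empty_iff.2 e1, Finset.filter_eq_empty_iff.2 e2]
        simpa using this
      all_goals
        intro i j h1 h2
        simp only [Es i j h1 h2]
        omega

lemma entry_lt (T : LRFilling π μ ν) (i j : ℕ) (h2 : (i, j) ∈ π) (h1 : (i, j) ∉ μ) :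
    T.entry i j < ν.colLen 0 := by
  rw [← YoungDiagram.mem_iff_lt_colLen, YoungDiagram.mem_iff_lt_rowLen, ← T.content,
    Finset.card_pos]
  exact ⟨(i, j), by simp only [Finset.mem_filter, mem_skew]; exact ⟨⟨h2, h1⟩, trivial⟩⟩

lemma colLen_le (T : LRFilling π μ ν) : π.colLen 0 ≤ μ.colLen 0 + ν.colLen 0 := by
  by_contra hlt
  have h1 : (μ.colLen 0, 0) ∉ μ := by rw [YoungDiagram.mem_iff_lt_colLen]; omega
  have h2 : (μ.colLen 0 + ν.colLen 0, 0) ∈ π := by rw [YoungDiagram.mem_iff_lt_colLen]; omega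
  have h3 : (μ.colLen 0 + ν.colLen 0, 0) ∉ μ := by rw [YoungDiagram.mem_iff_lt_colLen]; omega
  have := T.col_mono _ _ _ h1 h2
  have := T.entry_lt _ _ h2 h3
  omega

lemma col0 (T : LRFilling π μ ν) (h : μ.colLen 0 + ν.colLen 0 ≤ π.colLen 0) (i : ℕ)
    (h2 : (i, 0) ∈ π) (h1 : (i, 0) ∉ μ) : T.entry i 0 = i - μ.colLen 0 := by
  have h2' := h2
  have h1' := h1
  rw [YoungDiagram.mem_iff_lt_colLen] at h1' h2'
  have h3 : (μ.colLen 0, 0) ∉ μ := by rw [YoungDiagram.mem_iff_lt_colLen]; omega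
  obtain ⟨d, rfl⟩ : ∃ d, i = μ.colLen 0 + d := ⟨i - μ.colLen 0, by omega⟩
  have h4 := T.col_mono _ _ _ h3 h2
  obtain ⟨e, he⟩ : ∃ e, π.colLen 0 = μ.colLen 0 + d + e + 1 :=
    ⟨π.colLen 0 - μ.colLen 0 - d - 1, by omega⟩
  have h5 : (μ.colLen 0 + d + e, 0) ∈ π := by rw [YoungDiagram.mem_iff_lt_colLen]; omega
  have h6 : (μ.colLen 0 + d + e, 0) ∉ μ := by rw [YoungDiagram.mem_iff_lt_colLen]; omega
  have h7 := T.col_mono _ _ _ h1 h5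
  have h8 := T.entry_lt _ _ h5 h6
  omega

lemma card_col0 (E : ℕ → ℕ → ℕ)
    (hE : ∀ i, (i, 0) ∈ π → (i, 0) ∉ μ → E i 0 = i - μ.colLen 0) (n : ℕ)
    (h : μ.colLen 0 + n = π.colLen 0) (P : ℕ × ℕ → Prop) [DecidablePred P] (k : ℕ)
    (Q : Prop) [Decidable Q]
    (hP : ∀ i, (i, 0) ∈ π → (i, 0) ∉ μ → (P (i, 0) ↔ E i 0 = k ∧ Q)) :
    ((π.cells \ μ.cells).filter (fun c => c.2 = 0 ∧ P c)).card =
      if k < n ∧ Q then 1 else 0 := by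
  split_ifs with hk
  · rw [Finset.card_eq_one]
    refine ⟨(μ.colLen 0 + k, 0), ?_⟩
    ext ⟨i, j⟩
    simp only [Finset.mem_filter, mem_skew, Finset.mem_singleton, Prod.mk.injEq]
    constructor
    · rintro ⟨⟨h1, h2⟩, rfl, h3⟩
      rw [hP i h1 h2, hE i h1 h2] at h3
      rw [YoungDiagram.mem_iff_lt_colLen] at h1 h2
      omega
    · rintro ⟨rfl, rfl⟩
      have h1 : (μ.colLen 0 + k, 0) ∉ μ := by rw [YoungDiagram.mem_iff_lt_colLen]; omega
      have h2 : (μ.colLen 0 + k, 0) ∈ π := by rw [YoungDiagram.mem_iff_lt_colLen]; omega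
      refine ⟨⟨h2, h1⟩, rfl, ?_⟩
      rw [hP _ h2 h1, hE _ h2 h1]
      exact ⟨by omega, hk.2⟩
  · rw [Finset.card_eq_zero, Finset.filter_eq_empty_iff]
    rintro ⟨i, j⟩ hc ⟨h3, h4⟩
    simp only [mem_skew] at hc h3
    subst h3
    rw [hP i hc.1 hc.2, hE i hc.1 hc.2] at h4
    rw [YoungDiagram.mem_iff_lt_colLen, YoungDiagram.mem_iff_lt_colLen] at hc
    apply hk
    exact ⟨by omega, h4.2⟩

lemma rowLen_pos_iff (ν : YoungDiagram) (k : ℕ) : 0 < ν.rowLen k ↔ k < ν.colLen 0 := by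
  rw [← YoungDiagram.mem_iff_lt_colLen, YoungDiagram.mem_iff_lt_rowLen]

lemma stripCol_nonempty (T : LRFilling π μ ν) (h : μ.colLen 0 + ν.colLen 0 = π.colLen 0) :
    Nonempty (LRFilling (stripCol π) (stripCol μ) (stripCol ν)) := by
  have hc0 := T.col0 h.le
  refine ⟨⟨?_, fun i j => T.entry i (j + 1), ?_, ?_, ?_, ?_, ?_⟩⟩
  · rw [yd_le]
    intro i j
    rw [mem_stripCol, mem_stripCol]
    exact yd_le.1 T.le _ _
  · intro i j hm
    rw [mem_skew, mem_stripCol, mem_stripCol, ← mem_skew] at hm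
    simp [T.zeros _ _ hm]
  · intro i j h1 h2
    rw [mem_skew, mem_stripCol, mem_stripCol, ← mem_skew] at h1 h2
    exact T.row_weak _ _ h1 h2
  · intro i j h1 h2
    rw [mem_skew, mem_stripCol, mem_stripCol, ← mem_skew] at h1 h2
    exact T.col_strict _ _ h1 h2
  · intro k
    have h1 := T.content k
    rw [card_col π μ (fun c => T.entry c.1 c.2 = k) (fun c => T.entry c.1 (c.2 + 1) = k)
      (fun _ _ _ _ => Iff.rfl), card_col0 T.entry hc0 _ h _ k True (by simp)] at h1
    rw [rowLen_stripCol]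
    have h2 := rowLen_pos_iff ν k
    simp only [and_true] at h1
    split_ifs at h1 <;> omega
  · intro i j k
    have key : ∀ k, ((π.cells \ μ.cells).filter fun c =>
          (c.1 < i ∨ (c.1 = i ∧ j + 1 ≤ c.2)) ∧ T.entry c.1 c.2 = k).card =
        (((stripCol π).cells \ (stripCol μ).cells).filter fun c =>
          (c.1 < i ∨ (c.1 = i ∧ j ≤ c.2)) ∧ T.entry c.1 (c.2 + 1) = k).card +
        if k < ν.colLen 0 ∧ μ.colLen 0 + k < i then 1 else 0 := by
      intro k
      rw [card_col π μ (fun c => (c.1 < i ∨ (c.1 = i ∧ j + 1 ≤ c.2)) ∧ T.entry c.1 c.2 = k)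
        (fun c => (c.1 < i ∨ (c.1 = i ∧ j ≤ c.2)) ∧ T.entry c.1 (c.2 + 1) = k)
        (fun _ _ _ _ => by simp), card_col0 T.entry hc0 _ h _ k (μ.colLen 0 + k < i)]
      intro x h1 h2
      rw [hc0 x h1 h2]
      rw [YoungDiagram.mem_iff_lt_colLen] at h1 h2
      simp only
      omega
    have l1 := T.lattice i (j + 1) k
    have k1 := key k
    have k2 := key (k + 1)
    by_cases c1 : k < ν.colLen 0 ∧ μ.colLen 0 + k < i
    · by_cases c2 : k + 1 < ν.colLen 0
      · by_cases c3 : μ.colLen 0 + (k + 1) < i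
        · rw [if_pos ⟨c2, c3⟩] at k2
          rw [if_pos c1] at k1
          omega
        · obtain rfl : i = μ.colLen 0 + (k + 1) := by omega
          have m1 : (μ.colLen 0 + (k + 1), 0) ∈ π := by
            rw [YoungDiagram.mem_iff_lt_colLen]; omega
          have m2 : (μ.colLen 0 + (k + 1), 0) ∉ μ := by
            rw [YoungDiagram.mem_iff_lt_colLen]; omega
          have m3 := hc0 _ m1 m2
          have l2 := T.lattice (μ.colLen 0 + (k + 1)) 0 k
          have l3 : ((π.cells \ μ.cells).filter fun c =>
              (c.1 < μ.colLen 0 + (k + 1) ∨ (c.1 = μ.colLen 0 + (k + 1) ∧ 0 ≤ c.2)) ∧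
                T.entry c.1 c.2 = k).card ≤
              ((π.cells \ μ.cells).filter fun c =>
              (c.1 < μ.colLen 0 + (k + 1) ∨ (c.1 = μ.colLen 0 + (k + 1) ∧ j + 1 ≤ c.2)) ∧
                T.entry c.1 c.2 = k).card := by
            apply Finset.card_le_card
            rintro ⟨x, y⟩ hc
            simp only [Finset.mem_filter, mem_skew] at hc ⊢
            obtain ⟨hc, h1, h2⟩ := hc
            refine ⟨hc, ?_, h2⟩
            rcases h1 with h1 | ⟨rfl, _⟩
            · exact Or.inl h1
            · have := T.row_mono _ 0 y m2 (by simpa using hc.1)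
              rw [zero_add] at this
              omega
          have l4 : ((π.cells \ μ.cells).filter fun c =>
              (c.1 < μ.colLen 0 + (k + 1) ∨ (c.1 = μ.colLen 0 + (k + 1) ∧ j + 1 ≤ c.2)) ∧
                T.entry c.1 c.2 = k + 1).card <
              ((π.cells \ μ.cells).filter fun c =>
              (c.1 < μ.colLen 0 + (k + 1) ∨ (c.1 = μ.colLen 0 + (k + 1) ∧ 0 ≤ c.2)) ∧
                T.entry c.1 c.2 = k + 1).card := by
            apply Finset.card_lt_card
            rw [Finset.ssubset_iff_of_subset]
            · refine ⟨(μ.colLen 0 + (k + 1), 0), ?_, ?_⟩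
              · simp only [Finset.mem_filter, mem_skew]
                exact ⟨⟨m1, m2⟩, Or.inr ⟨trivial, le_rfl⟩, m3.trans (by omega)⟩
              · simp only [Finset.mem_filter, mem_skew]
                omega
            · apply Finset.monotone_filter_right
              rintro c _ ⟨h1, h2⟩
              exact ⟨by omega, h2⟩
          rw [if_pos c1] at k1
          omega
      · have l3 : ((π.cells \ μ.cells).filter fun c =>
          (c.1 < i ∨ (c.1 = i ∧ j + 1 ≤ c.2)) ∧ T.entry c.1 c.2 = k + 1).card ≤
            ν.rowLen (k + 1) := by
          rw [← T.content]
          apply Finset.card_le_card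
          apply Finset.monotone_filter_right
          rintro c _ ⟨_, h⟩
          exact h
        have := rowLen_pos_iff ν (k + 1)
        omega
    · rw [if_neg c1] at k1
      omega

lemma of_stripCol (T : LRFilling (stripCol π) (stripCol μ) (stripCol ν))
    (h : μ.colLen 0 + ν.colLen 0 = π.colLen 0) : Nonempty (LRFilling π μ ν) := by
  set E : ℕ → ℕ → ℕ := fun i j =>
    if (i, j) ∈ π.cells \ μ.cells then
      (if j = 0 then i - μ.colLen 0 else T.entry i (j - 1)) else 0 with hE
  have E0 : ∀ i, (i, 0) ∈ π → (i, 0) ∉ μ → E i 0 = i - μ.colLen 0 := by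
    intro i h1 h2
    simp [hE, h1, h2]
  have Es : ∀ i j, (i, j + 1) ∈ π → (i, j + 1) ∉ μ → E i (j + 1) = T.entry i j := by
    intro i j h1 h2
    simp [hE, h1, h2]
  refine ⟨⟨?_, E, ?_, ?_, ?_, ?_, ?_⟩⟩
  · rw [yd_le]
    intro i j
    rcases j with _ | j
    · rw [YoungDiagram.mem_iff_lt_colLen, YoungDiagram.mem_iff_lt_colLen]
      omega
    · rw [← mem_stripCol, ← mem_stripCol]
      exact yd_le.1 T.le _ _
  · intro i j hm
    simp only [hE]
    rw [if_neg hm]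
  · intro i j h1 h2
    rw [mem_skew] at h1 h2
    rcases j with _ | j
    · rw [E0 _ h1.1 h1.2, Es _ _ h2.1 h2.2]
      have h3 := h1.2
      rw [YoungDiagram.mem_iff_lt_colLen] at h3
      have h4 : (μ.colLen 0, 0) ∉ stripCol μ := by
        rw [mem_stripCol]
        intro h5
        have := μ.up_left_mem le_rfl (Nat.zero_le 1) h5
        rw [YoungDiagram.mem_iff_lt_colLen] at this
        omega
      have := T.col_mono (μ.colLen 0) 0 (i - μ.colLen 0) h4 (by
        rw [mem_stripCol, Nat.add_sub_cancel' (by omega)]; exact h2.1)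
      rw [Nat.add_sub_cancel' (by omega)] at this
      omega
    · rw [Es _ _ h1.1 h1.2, Es _ _ h2.1 h2.2]
      exact T.row_weak i j (by rwa [mem_skew, mem_stripCol, mem_stripCol])
        (by rwa [mem_skew, mem_stripCol, mem_stripCol])
  · intro i j h1 h2
    rw [mem_skew] at h1 h2
    rcases j with _ | j
    · rw [E0 _ h1.1 h1.2, E0 _ h2.1 h2.2]
      rw [YoungDiagram.mem_iff_lt_colLen, YoungDiagram.mem_iff_lt_colLen] at h1
      omega
    · rw [Es _ _ h1.1 h1.2, Es _ _ h2.1 h2.2]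
      exact T.col_strict i j (by rwa [mem_skew, mem_stripCol, mem_stripCol])
        (by rwa [mem_skew, mem_stripCol, mem_stripCol])
  · intro k
    have h1 := T.content k
    rw [card_col π μ (fun c => E c.1 c.2 = k) (fun c => T.entry c.1 c.2 = k)
      (fun i j h1 h2 => by simp only [Es i j h1 h2]),
      card_col0 E E0 _ h _ k True (by simp), h1, rowLen_stripCol]
    have h2 := rowLen_pos_iff ν k
    simp only [and_true]
    split_ifs <;> omega
  · intro i j k
    have key : ∀ k, ((π.cells \ μ.cells).filter fun c =>
          (c.1 < i ∨ (c.1 = i ∧ j ≤ c.2)) ∧ E c.1 c.2 = k).card =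
        (((stripCol π).cells \ (stripCol μ).cells).filter fun c =>
          (c.1 < i ∨ (c.1 = i ∧ j - 1 ≤ c.2)) ∧ T.entry c.1 c.2 = k).card +
        if k < ν.colLen 0 ∧ (μ.colLen 0 + k < i ∨ (μ.colLen 0 + k = i ∧ j = 0))
          then 1 else 0 := by
      intro k
      rw [card_col π μ (fun c => (c.1 < i ∨ (c.1 = i ∧ j ≤ c.2)) ∧ E c.1 c.2 = k)
        (fun c => (c.1 < i ∨ (c.1 = i ∧ j - 1 ≤ c.2)) ∧ T.entry c.1 c.2 = k)
        (fun i j h1 h2 => by simp only [Es i j h1 h2]; omega), card_col0 E E0 _ h _ k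
          (μ.colLen 0 + k < i ∨ (μ.colLen 0 + k = i ∧ j = 0))]
      intro x h1 h2
      rw [E0 x h1 h2]
      rw [YoungDiagram.mem_iff_lt_colLen] at h1 h2
      simp only
      omega
    have l1 := T.lattice i (j - 1) k
    rw [key, key]
    split_ifs <;> omega

lemma finite : Finite (LRFilling π μ ν) := by
  have : Function.Injective (fun (T : LRFilling π μ ν) (c : (π.cells \ μ.cells : Finset _)) =>
      (⟨T.entry c.1.1 c.1.2, by
        have := (mem_skew π μ c.1.1 c.1.2).1 c.2
        exact T.entry_lt _ _ this.1 this.2⟩ : Fin (ν.colLen 0))) := by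
    intro T T' hT
    have : T.entry = T'.entry := by
      funext i j
      by_cases hm : (i, j) ∈ π.cells \ μ.cells
      · have := congrFun hT ⟨(i, j), hm⟩
        simpa using this
      · rw [T.zeros _ _ hm, T'.zeros _ _ hm]
    cases T; cases T'; simp_all
  exact Finite.of_injective _ this

end LRFilling

lemma exists_addRow (n : ℕ) (π' : YoungDiagram) (h : π'.rowLen 0 ≤ n) :
    ∃ π : YoungDiagram, stripRow π = π' ∧ π.rowLen 0 = n ∧ π.colLen 0 ≤ π'.colLen 0 + 1 := by
  have hmem : ∀ i j, (i, j) ∈ ({0} ×ˢ Finset.range n) ∪ π'.cells.image (fun c => (c.1 + 1, c.2)) ↔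
      (i = 0 ∧ j < n) ∨ ∃ i', i = i' + 1 ∧ (i', j) ∈ π' := by
    intro i j
    simp only [Finset.mem_union, Finset.mem_product, Finset.mem_singleton, Finset.mem_range,
      Finset.mem_image, YoungDiagram.mem_cells, Prod.exists, Prod.mk.injEq]
    constructor
    · rintro (h | ⟨x, y, h1, rfl, rfl⟩)
      · exact Or.inl h
      · exact Or.inr ⟨x, rfl, h1⟩
    · rintro (h | ⟨x, rfl, h1⟩)
      · exact Or.inl h
      · exact Or.inr ⟨x, j, h1, rfl, rfl⟩
  let π : YoungDiagram :=
    ⟨({0} ×ˢ Finset.range n) ∪ π'.cells.image (fun c => (c.1 + 1, c.2)), by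
      rintro ⟨i, j⟩ ⟨i', j'⟩ ⟨hi, hj⟩ hm
      simp only at hi hj
      rw [Finset.mem_coe, hmem] at hm ⊢
      rcases i' with _ | i'
      · left
        refine ⟨rfl, ?_⟩
        rcases hm with ⟨_, h1⟩ | ⟨x, rfl, h1⟩
        · omega
        · have h2 := π'.up_left_mem (Nat.zero_le x) hj h1
          rw [YoungDiagram.mem_iff_lt_rowLen] at h2
          omega
      · right
        refine ⟨i', rfl, ?_⟩
        rcases hm with ⟨h0, _⟩ | ⟨x, rfl, h1⟩
        · omega
        · exact π'.up_left_mem (by omega) hj h1⟩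
  have hπ : ∀ i j, (i, j) ∈ π ↔ (i = 0 ∧ j < n) ∨ ∃ i', i = i' + 1 ∧ (i', j) ∈ π' := hmem
  refine ⟨π, ?_, ?_, ?_⟩
  · apply yd_ext
    intro i j
    rw [mem_stripRow, hπ]
    simp
  · apply eq_of_forall_lt_iff
    intro c
    rw [← YoungDiagram.mem_iff_lt_rowLen, hπ]
    simp
  · by_contra hlt
    have : (π'.colLen 0 + 1, 0) ∈ π := by rw [YoungDiagram.mem_iff_lt_colLen]; omega
    rw [hπ] at this
    rcases this with h | ⟨x, hx, h1⟩
    · omega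
    · rw [YoungDiagram.mem_iff_lt_colLen] at h1
      omega

lemma exists_addCol (n : ℕ) (π' : YoungDiagram) (h : π'.colLen 0 ≤ n) :
    ∃ π : YoungDiagram, stripCol π = π' ∧ π.colLen 0 = n ∧ π.rowLen 0 ≤ π'.rowLen 0 + 1 := by
  obtain ⟨π, h1, h2, h3⟩ := exists_addRow n π'.transpose (by simpa using h)
  refine ⟨π.transpose, ?_, ?_, ?_⟩
  · rw [stripCol, YoungDiagram.transpose_transpose, h1, YoungDiagram.transpose_transpose]
  · simpa using h2
  · simpa using h3

lemma rowLen_eq_of (a b : ℕ) (hb : 0 < b) (μ : YoungDiagram) (hμ : μ ≤ rect a b) :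
    μ.rowLen 0 ≤ b ∧ ((0, b - 1) ∈ μ ↔ μ.rowLen 0 = b) := by
  have h1 : μ.rowLen 0 ≤ b := by
    by_contra hlt
    have : (0, b) ∈ μ := by rw [YoungDiagram.mem_iff_lt_rowLen]; omega
    have := (mem_rect _ _ _ _).1 (yd_le.1 hμ _ _ this)
    omega
  refine ⟨h1, ?_⟩
  rw [YoungDiagram.mem_iff_lt_rowLen]
  omega

lemma colLen_eq_of (a b : ℕ) (ha : 0 < a) (μ : YoungDiagram) (hμ : μ ≤ rect a b) :
    μ.colLen 0 ≤ a ∧ ((a - 1, 0) ∈ μ ↔ μ.colLen 0 = a) := by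
  have h1 : μ.colLen 0 ≤ a := by
    by_contra hlt
    have : (a, 0) ∈ μ := by rw [YoungDiagram.mem_iff_lt_colLen]; omega
    have := (mem_rect _ _ _ _).1 (yd_le.1 hμ _ _ this)
    omega
  refine ⟨h1, ?_⟩
  rw [YoungDiagram.mem_iff_lt_colLen]
  omega

lemma rectCompl_le (a b : ℕ) (μ : YoungDiagram) : rectCompl a b μ ≤ rect a b := by
  rw [yd_le]
  intro i j h
  rw [mem_rectCompl] at h
  exact (mem_rect _ _ _ _).2 h.1

lemma stripRow_facts (a b : ℕ) (μ : YoungDiagram) (hμ : μ ≤ rect (a + 2) b)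
    (h1 : (0, b - 1) ∈ μ) (h2 : (a + 1, 0) ∉ μ) :
    stripRow μ ≤ rect a b ∧
      stripRow (rectCompl (a + 2) b μ) = rectCompl a b (stripRow μ) := by
  constructor
  · rw [yd_le]
    intro i j h
    rw [mem_stripRow] at h
    have h3 := (mem_rect _ _ _ _).1 (yd_le.1 hμ _ _ h)
    rw [mem_rect]
    refine ⟨?_, h3.2⟩
    by_contra h4
    exact h2 (μ.up_left_mem (by omega) (Nat.zero_le _) h)
  · apply yd_ext
    intro i j
    rw [mem_stripRow, mem_rectCompl, mem_rectCompl, mem_stripRow]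
    by_cases hi : i < a
    · have e : a + 2 - 1 - (i + 1) = a - 1 - i + 1 := by omega
      rw [e]
      refine and_congr_left fun _ => ?_
      omega
    · constructor
      · rintro ⟨h3, h4⟩
        exact absurd (μ.up_left_mem (by omega) (by omega) h1) h4
      · rintro ⟨h3, h4⟩
        omega

lemma stripCol_facts (a b : ℕ) (μ : YoungDiagram) (hμ : μ ≤ rect a (b + 2))
    (h1 : (a - 1, 0) ∈ μ) (h2 : (0, b + 1) ∉ μ) :
    stripCol μ ≤ rect a b ∧
      stripCol (rectCompl a (b + 2) μ) = rectCompl a b (stripCol μ) := by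
  constructor
  · rw [yd_le]
    intro i j h
    rw [mem_stripCol] at h
    have h3 := (mem_rect _ _ _ _).1 (yd_le.1 hμ _ _ h)
    rw [mem_rect]
    refine ⟨h3.1, ?_⟩
    by_contra h4
    exact h2 (μ.up_left_mem (Nat.zero_le _) (by omega) h)
  · apply yd_ext
    intro i j
    rw [mem_stripCol, mem_rectCompl, mem_rectCompl, mem_stripCol]
    by_cases hi : j < b
    · have e : b + 2 - 1 - (j + 1) = b - 1 - j + 1 := by omega
      rw [e]
      refine and_congr_left fun _ => ?_
      omega
    · constructor
      · rintro ⟨h3, h4⟩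
        exact absurd (μ.up_left_mem (by omega) (by omega) h1) h4
      · rintro ⟨h3, h4⟩
        omega

lemma eq_of_stripRow {μ lam : YoungDiagram} (h : stripRow μ = stripRow lam)
    (h0 : μ.rowLen 0 = lam.rowLen 0) : μ = lam := by
  apply yd_ext
  intro i j
  rcases i with _ | i
  · rw [YoungDiagram.mem_iff_lt_rowLen, YoungDiagram.mem_iff_lt_rowLen, h0]
  · rw [← mem_stripRow, h, mem_stripRow]

lemma eq_of_stripCol {μ lam : YoungDiagram} (h : stripCol μ = stripCol lam)
    (h0 : μ.colLen 0 = lam.colLen 0) : μ = lam := by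
  apply yd_ext
  intro i j
  rcases j with _ | j
  · rw [YoungDiagram.mem_iff_lt_colLen, YoungDiagram.mem_iff_lt_colLen, h0]
  · rw [← mem_stripCol, h, mem_stripCol]

lemma witness_aux (N : ℕ) : ∀ (a b : ℕ), a + b ≤ N → ∀ lam : YoungDiagram, lam ≤ rect a b →
    rectCompl a b lam = lam →
    ∃ π : YoungDiagram, π.rowLen 0 ≤ 2 * b ∧ π.colLen 0 ≤ 2 * a ∧
      ∀ μ : YoungDiagram, μ ≤ rect a b →
        (Nonempty (LRFilling π μ (rectCompl a b μ)) ↔ μ = lam) := by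
  induction N using Nat.strong_induction_on with
  | _ N ih =>
  intro a b hN lam hlam hsc
  by_cases hab : a = 0 ∨ b = 0
  · have hbot : ∀ μ : YoungDiagram, μ ≤ rect a b → μ = ⊥ := by
      intro μ hμ
      apply yd_ext
      intro i j
      constructor
      · intro h
        have := (mem_rect _ _ _ _).1 (yd_le.1 hμ _ _ h)
        omega
      · intro h
        simp at h
    have r0 : ∀ k, (⊥ : YoungDiagram).rowLen k = 0 := by
      intro k
      by_contra hne
      have : (k, 0) ∈ (⊥ : YoungDiagram) := by
        rw [YoungDiagram.mem_iff_lt_rowLen]; omega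
      simp at this
    have c0 : (⊥ : YoungDiagram).colLen 0 = 0 := by
      by_contra hne
      have : (0, 0) ∈ (⊥ : YoungDiagram) := by
        rw [YoungDiagram.mem_iff_lt_colLen]; omega
      simp at this
    refine ⟨⊥, by rw [r0]; omega, by rw [c0]; omega, ?_⟩
    intro μ hμ
    rw [hbot μ hμ, hbot lam hlam, hbot _ (rectCompl_le a b ⊥)]
    refine ⟨fun _ => rfl, fun _ => ⟨⟨le_rfl, fun _ _ => 0, ?_, ?_, ?_, ?_, ?_⟩⟩⟩ <;>
      simp [r0]
  have ha : 0 < a := by omega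
  have hb : 0 < b := by omega
  by_cases hc : (0, b - 1) ∈ lam
  · have hc2 : (a - 1, 0) ∉ lam := by
      have h := hc
      rw [← hsc, mem_rectCompl] at h
      simpa using h.2
    obtain ⟨a, rfl⟩ : ∃ a', a = a' + 2 := by
      refine ⟨a - 2, ?_⟩
      by_contra h
      obtain rfl : a = 1 := by omega
      exact hc2 (lam.up_left_mem le_rfl (Nat.zero_le _) hc)
    replace hc2 : (a + 1, 0) ∉ lam := hc2
    obtain ⟨f1, f2⟩ := stripRow_facts a b lam hlam hc hc2
    rw [hsc] at f2
    obtain ⟨π', p1, p2, p3⟩ := ih (a + b) (by omega) a b le_rfl (stripRow lam) f1 f2.symm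
    obtain ⟨π, q1, q2, q3⟩ := exists_addRow (2 * b) π' p1
    refine ⟨π, by omega, by omega, ?_⟩
    intro μ hμ
    have e1 := rowLen_eq_of _ b hb μ hμ
    have e2 := rowLen_eq_of _ b hb _ (rectCompl_le (a + 2) b μ)
    have e3 : (0, b - 1) ∈ rectCompl (a + 2) b μ ↔ (a + 1, 0) ∉ μ := by
      rw [mem_rectCompl]
      simp [hb]
    have e4 := rowLen_eq_of _ b hb lam hlam
    constructor
    · rintro ⟨T⟩
      have t1 := T.rowLen_le
      have m1 := e1.2.2 (by omega)
      have m2 := e3.1 (e2.2.2 (by omega))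
      obtain ⟨g1, g2⟩ := stripRow_facts a b μ hμ m1 m2
      have t2 := T.stripRow_nonempty (by omega)
      rw [q1, g2, p3 _ g1] at t2
      exact eq_of_stripRow t2 (by rw [e4.2.1 hc, e1.2.1 m1])
    · rintro rfl
      obtain ⟨T⟩ := (p3 _ f1).2 rfl
      rw [← f2, ← q1] at T
      rw [hsc]
      apply LRFilling.of_stripRow T
      rw [e4.2.1 hc]
      omega
  · have hc2 : (a - 1, 0) ∈ lam := by
      have h := hc
      rw [← hsc, mem_rectCompl] at h
      simpa [ha, hb] using h
    obtain ⟨b, rfl⟩ : ∃ b', b = b' + 2 := by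
      refine ⟨b - 2, ?_⟩
      by_contra h
      obtain rfl : b = 1 := by omega
      exact hc (lam.up_left_mem (Nat.zero_le _) le_rfl hc2)
    replace hc : (0, b + 1) ∉ lam := hc
    obtain ⟨f1, f2⟩ := stripCol_facts a b lam hlam hc2 hc
    rw [hsc] at f2
    obtain ⟨π', p1, p2, p3⟩ := ih (a + b) (by omega) a b le_rfl (stripCol lam) f1 f2.symm
    obtain ⟨π, q1, q2, q3⟩ := exists_addCol (2 * a) π' p2
    refine ⟨π, by omega, by omega, ?_⟩
    intro μ hμ
    have e1 := colLen_eq_of a _ ha μ hμ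
    have e2 := colLen_eq_of a _ ha _ (rectCompl_le a (b + 2) μ)
    have e3 : (a - 1, 0) ∈ rectCompl a (b + 2) μ ↔ (0, b + 1) ∉ μ := by
      rw [mem_rectCompl]
      simp [ha]
    have e4 := colLen_eq_of a _ ha lam hlam
    constructor
    · rintro ⟨T⟩
      have t1 := T.colLen_le
      have m1 := e1.2.2 (by omega)
      have m2 := e3.1 (e2.2.2 (by omega))
      obtain ⟨g1, g2⟩ := stripCol_facts a b μ hμ m1 m2
      have t2 := T.stripCol_nonempty (by omega)
      rw [q1, g2, p3 _ g1] at t2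
      exact eq_of_stripCol t2 (by rw [e4.2.1 hc2, e1.2.1 m1])
    · rintro rfl
      obtain ⟨T⟩ := (p3 _ f1).2 rfl
      rw [← f2, ← q1] at T
      rw [hsc]
      apply LRFilling.of_stripCol T
      rw [e4.2.1 hc2]
      omega

/-- For every self-complementary partition `lam` in the `a × b`
rectangle `R` there is a witness `π`: a partition such that for all `μ ⊆ R`, the
Littlewood–Richardson coefficient `c^π_{μ, μᶜ}` is nonzero iff `μ = lam`. -/
theorem statement14 (a b : ℕ) (ha : 0 < a) (hb : 0 < b) (lam : YoungDiagram)
    (hlam : lam ≤ rect a b) (hsc : rectCompl a b lam = lam) :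
    ∃ π : YoungDiagram, ∀ μ : YoungDiagram, μ ≤ rect a b →
      (lrCoeff π μ (rectCompl a b μ) ≠ 0 ↔ μ = lam) := by
  obtain ⟨π, _, _, h⟩ := witness_aux (a + b) a b le_rfl lam hlam hsc
  refine ⟨π, fun μ hμ => ?_⟩
  rw [← h μ hμ, lrCoeff]
  have := LRFilling.finite (π := π) (μ := μ) (ν := rectCompl a b μ)
  rw [← Nat.pos_iff_ne_zero, Nat.card_pos_iff]
  exact ⟨fun h => h.1, fun h => ⟨h, this⟩⟩
end
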